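/- Let n ≥ 1, let K ⊂ ℝⁿ be a convex body with 0 in its interior, let Φ be an n-dimensional Young function, and let u ∈ V^{1,Φ}_d(ℝⁿ). Then u^K ∈ V^{1,Φ_{•K•}}_d(ℝⁿ) and ∫_{ℝⁿ} Φ_{•K•}(∇u^K) dx ≤ ∫_{ℝⁿ} Φ(∇u) dx. -/

import Mathlib

open MeasureTheory Filter Set
open scoped ENNReal NNReal Topology Pointwise symmDiff RealInnerProductSpace

noncomputable section

/-- Euclidean space `ℝⁿ`. -/
abbrev Euc (n : ℕ) := EuclideanSpace ℝ (Fin n)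

/-- Convexity for `ℝ≥0∞`-valued functions on `ℝⁿ`. -/
def ConvexOnE {n : ℕ} (Φ : Euc n → ℝ≥0∞) : Prop :=
  ∀ x y : Euc n, ∀ a b : ℝ, 0 ≤ a → 0 ≤ b → a + b = 1 →
    Φ (a • x + b • y) ≤ ENNReal.ofReal a * Φ x + ENNReal.ofReal b * Φ y

/-- Strict convexity for `ℝ≥0∞`-valued functions on `ℝⁿ`. -/
def StrictConvexOnE {n : ℕ} (Φ : Euc n → ℝ≥0∞) : Prop :=
  ∀ x y : Euc n, x ≠ y → ∀ a b : ℝ, 0 < a → 0 < b → a + b = 1 →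
    Φ (a • x + b • y) < ENNReal.ofReal a * Φ x + ENNReal.ofReal b * Φ y

/-- An `n`-dimensional Young function: convex, lower semicontinuous, finite near `0`,
vanishing at `0`, tending to `∞` at infinity. -/
structure IsNYoung {n : ℕ} (Φ : Euc n → ℝ≥0∞) : Prop where
  convex : ConvexOnE Φ
  lsc : LowerSemicontinuous Φ
  finite_near_zero : ∃ ε : ℝ, 0 < ε ∧ ∀ x : Euc n, ‖x‖ < ε → Φ x ≠ ⊤
  map_zero : Φ 0 = 0
  coercive : Tendsto Φ (Bornology.cobounded (Euc n)) (𝓝 ⊤)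

/-- A convex body: a compact convex set. -/
def IsConvexBody {n : ℕ} (K : Set (Euc n)) : Prop :=
  IsCompact K ∧ Convex ℝ K

/-- The Young conjugate (Legendre transform) `Φ_•(ξ) = sup_η (⟨ξ,η⟩ - Φ(η))`,
`ℝ≥0∞`-valued (the supremum is nonnegative whenever `Φ 0 = 0`). -/
def yconj {n : ℕ} (Φ : Euc n → ℝ≥0∞) (ξ : Euc n) : ℝ≥0∞ :=
  ⨆ η : Euc n, ENNReal.ofReal ⟪ξ, η⟫ - Φ η

/-- The subgradient of an `ℝ≥0∞`-valued function. -/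
def subgrad {n : ℕ} (Ψ : Euc n → ℝ≥0∞) (ξ : Euc n) : Set (Euc n) :=
  {ζ | ∀ η : Euc n, (Ψ ξ : EReal) + ((⟪ζ, η - ξ⟫ : ℝ) : EReal) ≤ (Ψ η : EReal)}

/-- The support function of a set, real-valued. -/
def suppFnR {n : ℕ} (C : Set (Euc n)) (ξ : Euc n) : ℝ :=
  sSup ((fun η => ⟪ξ, η⟫) '' C)

/-- The support function of a set, `EReal`-valued. -/
def suppFnE {n : ℕ} (C : Set (Euc n)) (ξ : Euc n) : EReal :=
  ⨆ η ∈ C, ((⟪ξ, η⟫ : ℝ) : EReal)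

/-- The polar body `L° = {x : ⟨x,y⟩ ≤ 1 ∀ y ∈ L}`. -/
def polarBody {n : ℕ} (L : Set (Euc n)) : Set (Euc n) :=
  {x | ∀ y ∈ L, ⟪x, y⟫ ≤ 1}

/-- `E^K`: the dilate `cK` of `K` with `|cK| = |E|`. -/
def setSymm {n : ℕ} (K E : Set (Euc n)) : Set (Euc n) :=
  (((volume E).toReal / (volume K).toReal) ^ ((1 : ℝ) / n)) • K

/-- The distribution function `μ(t) = |{u > t}|`. -/
def distFn {n : ℕ} (u : Euc n → ℝ) (t : ℝ) : ℝ≥0∞ := volume {x | t < u x}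

/-- The decreasing rearrangement `u*(s) = inf {t : μ(t) ≤ s}`. -/
def decRearr {n : ℕ} (u : Euc n → ℝ) (s : ℝ) : ℝ :=
  sInf {t : ℝ | distFn u t ≤ ENNReal.ofReal s}

/-- The symmetral `u^K(x) = u*(|K| H₀^K(x)ⁿ)` of `u` with respect to `K`. -/
def funcSymm {n : ℕ} (K : Set (Euc n)) (u : Euc n → ℝ) (x : Euc n) : ℝ :=
  decRearr u ((volume K).toReal * gauge K x ^ n)

/-- The symmetral `Ψ_K` of an `n`-dimensional Young function `Ψ` with respect to `K`,
characterized by `{Ψ_K ≤ t} = −({Ψ ≤ t}^K)`; equivalently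
`Ψ_K(ξ) = inf {t : |K| H₀^K(−ξ)ⁿ ≤ |{Ψ ≤ t}|}`. -/
def youngSymm {n : ℕ} (K : Set (Euc n)) (Ψ : Euc n → ℝ≥0∞) (ξ : Euc n) : ℝ≥0∞ :=
  sInf {t : ℝ≥0∞ | volume K * ENNReal.ofReal (gauge K (-ξ) ^ n) ≤ volume {η | Ψ η ≤ t}}

/-- The essential infimum of a real function on `ℝⁿ`, valued in `EReal`. -/
def eInf {n : ℕ} (u : Euc n → ℝ) : EReal := essInf (fun x => (u x : EReal)) volume

/-- The essential supremum of a real function on `ℝⁿ`, valued in `EReal`. -/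
def eSup {n : ℕ} (u : Euc n → ℝ) : EReal := essSup (fun x => (u x : EReal)) volume

/-- `u ∈ M_d(ℝⁿ)`: measurable with `|{u > t}| < ∞` for all `t > ess inf u`. -/
def MemMd {n : ℕ} (u : Euc n → ℝ) : Prop :=
  Measurable u ∧ ∀ t : ℝ, eInf u < (t : EReal) → distFn u t < ⊤

/-- `g` is the weak gradient of `u ∈ W^{1,1}_loc(ℝⁿ)`. -/
def HasWeakGradient {n : ℕ} (u : Euc n → ℝ) (g : Euc n → Euc n) : Prop :=
  LocallyIntegrable u volume ∧ LocallyIntegrable g volume ∧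
    ∀ φ : Euc n → ℝ, ContDiff ℝ (⊤ : ℕ∞) φ → HasCompactSupport φ →
      ∀ v : Euc n, ∫ x, u x * fderiv ℝ φ x v = - ∫ x, ⟪g x, v⟫ * φ x

/-- `u ∈ V^{1,Φ}_d(ℝⁿ)`, with weak gradient `g` and `∫ Φ(∇u) < ∞`. -/
def MemV1d {n : ℕ} (Φ : Euc n → ℝ≥0∞) (u : Euc n → ℝ) (g : Euc n → Euc n) : Prop :=
  HasWeakGradient u g ∧ MemMd u ∧ ∫⁻ x, Φ (g x) < ⊤

/-- A one-dimensional Young function (on `[0,∞)`, extended arbitrarily to `ℝ`). -/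
structure IsYoung1 (A : ℝ → ℝ≥0∞) : Prop where
  map_zero : A 0 = 0
  convex : ∀ x y : ℝ, 0 ≤ x → 0 ≤ y → ∀ a b : ℝ, 0 ≤ a → 0 ≤ b → a + b = 1 →
    A (a * x + b * y) ≤ ENNReal.ofReal a * A x + ENNReal.ofReal b * A y
  left_cont : ∀ t : ℝ, 0 < t → Tendsto A (𝓝[<] t) (𝓝 (A t))
  nonconst : ∃ s t : ℝ, 0 < s ∧ 0 < t ∧ A s ≠ A t

/-- The Young conjugate of a one-dimensional Young function. -/
def yconj1 (A : ℝ → ℝ≥0∞) (t : ℝ) : ℝ≥0∞ :=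
  ⨆ (s : ℝ) (_ : 0 ≤ s), ENNReal.ofReal (s * t) - A s

/-- The generalized (right-continuous) inverse of a one-dimensional Young function. -/
def rinv (A : ℝ → ℝ≥0∞) (s : ℝ≥0∞) : ℝ :=
  sSup {t : ℝ | 0 ≤ t ∧ A t ≤ s}

theorem Real.volume_add_volume_le {A B C : Set ℝ} (hA : MeasurableSet A) (hB : MeasurableSet B)
    (hA' : A.Nonempty) (hB' : B.Nonempty) (h : ∀ a ∈ A, ∀ b ∈ B, a + b ∈ C) :
    volume A + volume B ≤ volume C := by
  have key : ∀ K L : Set ℝ, IsCompact K → IsCompact L → K.Nonempty → L.Nonempty →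
      K ⊆ A → L ⊆ B → volume K + volume L ≤ volume C := by
    intro K L hK hL hK' hL' hKA hLB
    have ha := hK.sSup_mem hK'
    have hb := hL.sInf_mem hL'
    set a := sSup K
    set b := sInf L
    have h1 : volume ((fun x => x + b) '' K ∪ (fun x => a + x) '' L) = volume K + volume L := by
      rw [measure_union₀]
      · congr 1
        · rw [Set.image_add_right, measure_preimage_add_right]
        · rw [Set.image_add_left, measure_preimage_add]
      · exact (hL.image (by fun_prop)).measurableSet.nullMeasurableSet
      · refine measure_mono_null (t := {a + b}) ?_ (by simp)
        rintro x ⟨⟨y, hy, rfl⟩, ⟨z, hz, hzy⟩⟩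
        have h2 : y ≤ a := le_csSup hK.bddAbove hy
        have h3 : b ≤ z := csInf_le hL.bddBelow hz
        simp only at hzy
        simp only [mem_singleton_iff]
        linarith
    rw [← h1]
    refine measure_mono ?_
    rintro x (⟨y, hy, rfl⟩ | ⟨y, hy, rfl⟩)
    · exact h _ (hKA hy) _ (hLB hb)
    · exact h _ (hKA ha) _ (hLB hy)
  have approx : ∀ A : Set ℝ, MeasurableSet A → A.Nonempty →
      volume A = ⨆ (K : Set ℝ) (_ : IsCompact K ∧ K.Nonempty ∧ K ⊆ A), volume K := by
    intro A hA ⟨x, hx⟩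
    refine le_antisymm ?_ (iSup₂_le fun K hK => measure_mono hK.2.2)
    rw [hA.measure_eq_iSup_isCompact]
    refine iSup₂_le fun K hKA => iSup_le fun hK => ?_
    exact (measure_mono (subset_union_left (t := {x}))).trans
      (le_iSup₂ (f := fun (K : Set ℝ) (_ : IsCompact K ∧ K.Nonempty ∧ K ⊆ A) => volume K)
        (K ∪ {x}) ⟨hK.union isCompact_singleton, by simp, union_subset hKA (by simpa using hx)⟩)
  rw [approx A hA hA', approx B hB hB']
  refine ENNReal.biSup_add_biSup_le' ?_ ?_ ?_
  · exact ⟨{hA'.some}, isCompact_singleton, by simp, by simpa using hA'.some_mem⟩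
  · exact ⟨{hB'.some}, isCompact_singleton, by simp, by simpa using hB'.some_mem⟩
  · intro K hK L hL
    exact key K L hK.1 hL.1 hK.2.1 hL.2.1 hK.2.2 hL.2.2

theorem ENNReal.geom_mean_le_arith_mean_two {p q : ℝ} (hp : 0 < p) (hq : 0 < q) (hpq : p + q = 1)
    (a b : ℝ≥0∞) : a ^ p * b ^ q ≤ ENNReal.ofReal p * a + ENNReal.ofReal q * b := by
  rcases eq_or_ne a ⊤ with rfl | ha
  · simp [ENNReal.mul_top, hp]
  rcases eq_or_ne b ⊤ with rfl | hb
  · simp [ENNReal.mul_top, hq]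
  lift a to ℝ≥0 using ha
  lift b to ℝ≥0 using hb
  have := NNReal.geom_mean_le_arith_mean2_weighted p.toNNReal q.toNNReal a b
    (by rw [← Real.toNNReal_add hp.le hq.le, hpq, Real.toNNReal_one])
  rw [Real.coe_toNNReal _ hp.le, Real.coe_toNNReal _ hq.le] at this
  rw [← ENNReal.coe_rpow_of_nonneg _ hp.le, ← ENNReal.coe_rpow_of_nonneg _ hq.le]
  rw [ENNReal.ofReal, ENNReal.ofReal]
  exact_mod_cast this

theorem arith_lintegral_le_of_normalized {f g h : ℝ → ℝ} (hf : Measurable f) (hg : Measurable g)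
    (hh : Measurable h) (hf0 : ∀ x, 0 ≤ f x) (hg0 : ∀ x, 0 ≤ g x) (hh0 : ∀ x, 0 ≤ h x)
    (hf1 : ∀ x, f x ≤ 1) (hg1 : ∀ x, g x ≤ 1)
    (hf2 : ∀ t < 1, ∃ x, t < f x) (hg2 : ∀ t < 1, ∃ x, t < g x)
    {p q : ℝ} (hp : 0 < p) (hq : 0 < q) (hpq : p + q = 1)
    (H : ∀ x y, f x ^ p * g y ^ q ≤ h (p * x + q * y)) :
    ENNReal.ofReal p * (∫⁻ x, ENNReal.ofReal (f x)) +
      ENNReal.ofReal q * (∫⁻ x, ENNReal.ofReal (g x)) ≤ ∫⁻ x, ENNReal.ofReal (h x) := by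
  rw [lintegral_eq_lintegral_meas_lt _ (ae_of_all _ hf0) hf.aemeasurable,
    lintegral_eq_lintegral_meas_lt _ (ae_of_all _ hg0) hg.aemeasurable,
    lintegral_eq_lintegral_meas_lt _ (ae_of_all _ hh0) hh.aemeasurable]
  have mono : ∀ k : ℝ → ℝ, Measurable fun t => volume {a | t < k a} := fun k =>
    Antitone.measurable fun s t hst => measure_mono fun x hx => lt_of_le_of_lt hst hx
  rw [← lintegral_const_mul _ (mono f), ← lintegral_const_mul _ (mono g),
    ← lintegral_add_left ((mono f).const_mul _)]
  refine setLIntegral_mono (mono h) fun t ht => ?_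
  rcases lt_or_ge t 1 with h1 | h1
  · have e1 : ∀ (c : ℝ), 0 < c → ∀ A : Set ℝ,
        ENNReal.ofReal c * volume A = volume (c • A) := by
      intro c hc A
      simp [Measure.addHaar_smul, abs_of_pos hc]
    rw [e1 p hp, e1 q hq]
    refine Real.volume_add_volume_le ?_ ?_ ?_ ?_ ?_
    · exact (measurableSet_lt measurable_const hf).const_smul₀ p
    · exact (measurableSet_lt measurable_const hg).const_smul₀ q
    · exact Set.Nonempty.smul_set (hf2 t h1)
    · exact Set.Nonempty.smul_set (hg2 t h1)
    · rintro _ ⟨x, hx, rfl⟩ _ ⟨y, hy, rfl⟩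
      refine lt_of_lt_of_le ?_ (H x y)
      have ht0 : 0 < t := ht
      calc t = t ^ p * t ^ q := by rw [← Real.rpow_add ht0, hpq, Real.rpow_one]
        _ < f x ^ p * g y ^ q := by
          have a1 : t ^ p < f x ^ p := Real.rpow_lt_rpow ht0.le hx hp
          have a2 : t ^ q < g y ^ q := Real.rpow_lt_rpow ht0.le hy hq
          have a3 := Real.rpow_pos_of_pos ht0 p
          have a4 := Real.rpow_pos_of_pos ht0 q
          gcongr
  · have z : ∀ k : ℝ → ℝ, (∀ x, k x ≤ 1) → {a | t < k a} = ∅ := by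
      intro k hk
      ext x
      simpa using (hk x).trans h1
    simp [z f hf1, z g hg1]

theorem prekopa_leindler_real_of_bounded {f g h : ℝ → ℝ} (hf : Measurable f) (hg : Measurable g)
    (hh : Measurable h) (hf0 : ∀ x, 0 ≤ f x) (hg0 : ∀ x, 0 ≤ g x) (hh0 : ∀ x, 0 ≤ h x)
    (hf1 : BddAbove (range f)) (hg1 : BddAbove (range g))
    {p q : ℝ} (hp : 0 < p) (hq : 0 < q) (hpq : p + q = 1)
    (H : ∀ x y, f x ^ p * g y ^ q ≤ h (p * x + q * y)) :
    (∫⁻ x, ENNReal.ofReal (f x)) ^ p * (∫⁻ x, ENNReal.ofReal (g x)) ^ q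
      ≤ ∫⁻ x, ENNReal.ofReal (h x) := by
  set a := ⨆ x, f x with ha
  set b := ⨆ x, g x with hb
  have hfa : ∀ x, f x ≤ a := le_ciSup hf1
  have hgb : ∀ x, g x ≤ b := le_ciSup hg1
  rcases ((hf0 0).trans (hfa 0)).eq_or_lt with a0 | a0
  · have : ∀ x, f x = 0 := fun x => le_antisymm ((hfa x).trans a0.ge) (hf0 x)
    simp [this, hp]
  rcases ((hg0 0).trans (hgb 0)).eq_or_lt with b0 | b0
  · have : ∀ x, g x = 0 := fun x => le_antisymm ((hgb x).trans b0.ge) (hg0 x)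
    simp [this, hq]
  have c0 : 0 < a ^ p * b ^ q := by positivity
  have sup : ∀ (k : ℝ → ℝ) (s : ℝ), s = (⨆ x, k x) → 0 < s → ∀ t < 1, ∃ x, t < k x / s := by
    intro k s hs hs0 t ht
    have : t * s < ⨆ x, k x := by rw [← hs]; nlinarith
    obtain ⟨x, hx⟩ := exists_lt_of_lt_ciSup this
    exact ⟨x, (lt_div_iff₀ hs0).2 hx⟩
  have key := arith_lintegral_le_of_normalized (f := fun x => f x / a) (g := fun x => g x / b)
    (h := fun x => h x / (a ^ p * b ^ q)) (hf.div_const _) (hg.div_const _) (hh.div_const _)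
    (fun x => div_nonneg (hf0 x) a0.le) (fun x => div_nonneg (hg0 x) b0.le)
    (fun x => div_nonneg (hh0 x) c0.le) (fun x => (div_le_one a0).2 (hfa x))
    (fun x => (div_le_one b0).2 (hgb x)) (sup f a ha a0) (sup g b hb b0) hp hq hpq (by
      intro x y
      rw [Real.div_rpow (hf0 x) a0.le, Real.div_rpow (hg0 y) b0.le, div_mul_div_comm]
      exact div_le_div_of_nonneg_right (H x y) c0.le)
  have e : ∀ (k : ℝ → ℝ) (s : ℝ), 0 < s → Measurable k → ∫⁻ x, ENNReal.ofReal (k x)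
      = ENNReal.ofReal s * ∫⁻ x, ENNReal.ofReal (k x / s) := by
    intro k s hs hk
    rw [← lintegral_const_mul _ (by fun_prop)]
    refine lintegral_congr fun x => ?_
    rw [← ENNReal.ofReal_mul hs.le]
    congr 1
    field_simp
  rw [e f a a0 hf, e g b b0 hg, e h _ c0 hh, ENNReal.mul_rpow_of_nonneg _ _ hp.le,
    ENNReal.mul_rpow_of_nonneg _ _ hq.le, ENNReal.ofReal_rpow_of_pos a0,
    ENNReal.ofReal_rpow_of_pos b0, mul_mul_mul_comm, ← ENNReal.ofReal_mul (by positivity)]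
  gcongr
  exact (ENNReal.geom_mean_le_arith_mean_two hp hq hpq _ _).trans key

theorem prekopa_leindler_real {f g h : ℝ → ℝ≥0∞} (hf : Measurable f) (hg : Measurable g)
    (hh : Measurable h) {p q : ℝ} (hp : 0 < p) (hq : 0 < q) (hpq : p + q = 1)
    (H : ∀ x y, f x ^ p * g y ^ q ≤ h (p * x + q * y)) :
    (∫⁻ x, f x) ^ p * (∫⁻ x, g x) ^ q ≤ ∫⁻ x, h x := by
  have trunc : ∀ k : ℕ, (∫⁻ x, min (f x) k) ^ p * (∫⁻ x, min (g x) k) ^ q ≤ ∫⁻ x, h x := by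
    intro k
    have fin : ∀ a : ℝ≥0∞, min a k ≠ ⊤ := fun a =>
      ((min_le_right a k).trans_lt (ENNReal.natCast_lt_top k)).ne
    have e : ∀ a : ℝ≥0∞, ENNReal.ofReal (min a k).toReal = min a k := fun a =>
      ENNReal.ofReal_toReal (fin a)
    have bdd : ∀ f : ℝ → ℝ≥0∞, BddAbove (range fun x => (min (f x) (k : ℝ≥0∞)).toReal) := by
      rintro f
      refine ⟨k, ?_⟩
      rintro _ ⟨x, rfl⟩
      exact ENNReal.toReal_le_of_le_ofReal (by positivity) (by simp)
    have key := prekopa_leindler_real_of_bounded (f := fun x => (min (f x) k).toReal)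
      (g := fun x => (min (g x) k).toReal) (h := fun x => (min (h x) k).toReal)
      (by fun_prop) (by fun_prop) (by fun_prop) (fun _ => ENNReal.toReal_nonneg)
      (fun _ => ENNReal.toReal_nonneg) (fun _ => ENNReal.toReal_nonneg) (bdd f) (bdd g)
      hp hq hpq (by
        intro x y
        simp only [ENNReal.toReal_rpow]
        rw [← ENNReal.toReal_mul]
        refine ENNReal.toReal_mono (fin _) (le_min ?_ ?_)
        · refine le_trans ?_ (H x y)
          gcongr <;> exact min_le_left _ _
        · calc min (f x) (k : ℝ≥0∞) ^ p * min (g y) (k : ℝ≥0∞) ^ q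
              ≤ (k : ℝ≥0∞) ^ p * (k : ℝ≥0∞) ^ q := by
                gcongr <;> exact min_le_right _ _
            _ = k := by rw [← ENNReal.rpow_add_of_nonneg _ _ hp.le hq.le, hpq, ENNReal.rpow_one])
    simp only [e] at key
    exact key.trans (lintegral_mono fun x => min_le_left _ _)
  have lim : ∀ f : ℝ → ℝ≥0∞, Measurable f →
      Tendsto (fun k : ℕ => ∫⁻ x, min (f x) k) atTop (𝓝 (∫⁻ x, f x)) := by
    intro f hf
    refine lintegral_tendsto_of_tendsto_of_monotone (fun k => by fun_prop) ?_ ?_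
    · exact ae_of_all _ fun x i j hij => min_le_min le_rfl (by exact_mod_cast hij)
    · refine ae_of_all _ fun x => ?_
      have := (tendsto_const_nhds (x := f x)).min ENNReal.tendsto_nat_nhds_top
      simpa using this
  by_cases hf0 : ∫⁻ x, f x = 0
  · simp [hf0, hp]
  by_cases hg0 : ∫⁻ x, g x = 0
  · simp [hg0, hq]
  refine le_of_tendsto (ENNReal.Tendsto.mul
    (((ENNReal.continuous_rpow_const (y := p)).tendsto _).comp
    (lim f hf)) (Or.inl ?_) (((ENNReal.continuous_rpow_const (y := q)).tendsto _).comp (lim g hg))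
    (Or.inl ?_)) (Eventually.of_forall trunc)
  · simp [ENNReal.rpow_eq_zero_iff, hf0, hp.le]
  · simp [ENNReal.rpow_eq_zero_iff, hg0, hq.le]

theorem prekopa_leindler_pi {p q : ℝ} (hp : 0 < p) (hq : 0 < q) (hpq : p + q = 1) (n : ℕ)
    {f g h : (Fin n → ℝ) → ℝ≥0∞} (hf : Measurable f) (hg : Measurable g)
    (hh : Measurable h) (H : ∀ x y, f x ^ p * g y ^ q ≤ h (p • x + q • y)) :
    (∫⁻ x, f x) ^ p * (∫⁻ x, g x) ^ q ≤ ∫⁻ x, h x := by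
  induction n with
  | zero =>
    simp only [lintegral_unique, Measure.volume_pi_eq_dirac (0 : Fin 0 → ℝ), measure_univ, mul_one]
    convert! H default default using 3 <;> exact congrArg _ (Subsingleton.elim _ _)
  | succ n ih =>
    have e : ∀ f : (Fin (n + 1) → ℝ) → ℝ≥0∞, Measurable f →
        ∫⁻ x, f x = ∫⁻ t : ℝ, ∫⁻ y : Fin n → ℝ, f (Fin.cons t y) := by
      intro f hf
      have mp := (volume_preserving_piFinSuccAbove (fun _ : Fin (n + 1) => ℝ) 0).symm
      rw [← mp.lintegral_comp hf, Measure.volume_eq_prod,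
        lintegral_prod (fun z => f ((MeasurableEquiv.piFinSuccAbove (fun _ => ℝ) 0).symm z))
          (hf.comp mp.measurable).aemeasurable]
      simp [MeasurableEquiv.piFinSuccAbove, Fin.insertNthEquiv]
    have mc : Measurable fun z : ℝ × (Fin n → ℝ) => (Fin.cons z.1 z.2 : Fin (n + 1) → ℝ) := by
      refine measurable_pi_lambda _ fun i => ?_
      refine Fin.cases ?_ (fun i => ?_) i
      · simpa using measurable_fst
      · simp only [Fin.cons_succ]; fun_prop
    have mc' : ∀ t : ℝ, Measurable fun y : Fin n → ℝ => (Fin.cons t y : Fin (n + 1) → ℝ) :=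
      fun t => mc.comp (by fun_prop : Measurable fun y : Fin n → ℝ => (t, y))
    rw [e f hf, e g hg, e h hh]
    refine prekopa_leindler_real (hf.comp mc).lintegral_prod_right'
      (hg.comp mc).lintegral_prod_right' (hh.comp mc).lintegral_prod_right' hp hq hpq ?_
    intro s t
    refine ih (hf.comp (mc' _)) (hg.comp (mc' _)) (hh.comp (mc' _)) ?_
    intro x y
    refine (H _ _).trans (le_of_eq ?_)
    congr 1
    ext i
    refine Fin.cases ?_ (fun i => ?_) i <;> simp

theorem measure_add_ge_one {n : ℕ} {p q : ℝ} (hp : 0 < p) (hq : 0 < q) (hpq : p + q = 1)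
    {A B C : Set (Euc n)} (hA : MeasurableSet A) (hB : MeasurableSet B) (hC : MeasurableSet C)
    (h : ∀ a ∈ A, ∀ b ∈ B, p • a + q • b ∈ C) (hA1 : volume A = 1) (hB1 : volume B = 1) :
    1 ≤ volume C := by
  have e : ∀ A : Set (Euc n), MeasurableSet A →
      ∫⁻ x : Fin n → ℝ, A.indicator 1 (WithLp.toLp 2 x) = volume A := by
    intro A hA
    rw [(PiLp.volume_preserving_toLp (Fin n)).lintegral_comp (measurable_one.indicator hA),
      lintegral_indicator_one hA]
  have m : ∀ A : Set (Euc n), MeasurableSet A →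
      Measurable fun x : Fin n → ℝ => A.indicator (1 : Euc n → ℝ≥0∞) (WithLp.toLp 2 x) :=
    fun A hA =>
    (measurable_one.indicator hA).comp (PiLp.volume_preserving_toLp (Fin n)).measurable
  have key := prekopa_leindler_pi hp hq hpq n (m A hA) (m B hB) (m C hC) (by
    intro x y
    by_cases hx : WithLp.toLp 2 x ∈ A
    · by_cases hy : WithLp.toLp 2 y ∈ B
      · have : WithLp.toLp 2 (p • x + q • y) ∈ C := h _ hx _ hy
        rw [indicator_of_mem hx, indicator_of_mem hy, indicator_of_mem this]; simp
      · simp [hy, hq]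
    · simp [hx, hp])
  simpa [e A hA, e B hB, e C hC, hA1, hB1] using key

/-- The Brunn–Minkowski inequality. -/
theorem brunn_minkowski {n : ℕ} {A B C : Set (Euc n)} (hA : MeasurableSet A)
    (hB : MeasurableSet B) (hC : MeasurableSet C) (h : ∀ a ∈ A, ∀ b ∈ B, a + b ∈ C)
    {x y : ℝ} (hx : 0 < x) (hy : 0 < y) (hAx : volume A = ENNReal.ofReal (x ^ n))
    (hBy : volume B = ENNReal.ofReal (y ^ n)) : ENNReal.ofReal ((x + y) ^ n) ≤ volume C := by
  have sc : ∀ (c : ℝ) (A : Set (Euc n)), 0 < c →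
      volume (c⁻¹ • A) = ENNReal.ofReal ((c ^ n)⁻¹) * volume A := by
    intro c A hc
    rw [Measure.addHaar_smul, finrank_euclideanSpace_fin, abs_of_nonneg (by positivity), inv_pow]
  have one : ∀ c : ℝ, 0 < c → ENNReal.ofReal ((c ^ n)⁻¹) * ENNReal.ofReal (c ^ n) = 1 := by
    intro c hc
    rw [← ENNReal.ofReal_mul (by positivity), inv_mul_cancel₀ (by positivity), ENNReal.ofReal_one]
  have hxy : 0 < x + y := by positivity
  have key := measure_add_ge_one (p := x / (x + y)) (q := y / (x + y)) (by positivity)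
    (by positivity) (by field_simp) (A := x⁻¹ • A) (B := y⁻¹ • B) (C := (x + y)⁻¹ • C)
    (hA.const_smul₀ _) (hB.const_smul₀ _) (hC.const_smul₀ _) (by
      rintro _ ⟨a, ha, rfl⟩ _ ⟨b, hb, rfl⟩
      refine ⟨a + b, h a ha b hb, ?_⟩
      simp only [smul_add, smul_smul]
      congr 2 <;> field_simp)
    (by rw [sc x A hx, hAx, one x hx]) (by rw [sc y B hy, hBy, one y hy])
  rw [sc _ C hxy] at key
  calc ENNReal.ofReal ((x + y) ^ n) = ENNReal.ofReal ((x + y) ^ n) * 1 := by simp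
    _ ≤ ENNReal.ofReal ((x + y) ^ n) * (ENNReal.ofReal (((x + y) ^ n)⁻¹) * volume C) := by gcongr
    _ = volume C := by
      rw [← mul_assoc, mul_comm (ENNReal.ofReal ((x + y) ^ n)), one _ hxy, one_mul]

/-- The sup-convolution of `w` at scale `h` over the set `E`. -/
def supConv {n : ℕ} (E : Set (Euc n)) (h : ℝ) (w : Euc n → ℝ) (x : Euc n) : ℝ :=
  ⨆ η : E, w (x + h • (η : Euc n))

section SupConv

variable {n : ℕ} {E : Set (Euc n)} {w : Euc n → ℝ} {h : ℝ}

theorem bddAbove_range_supConv (hw : BddAbove (range w)) (x : Euc n) :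
    BddAbove (range fun η : E => w (x + h • (η : Euc n))) :=
  hw.mono (by rintro _ ⟨η, rfl⟩; exact ⟨_, rfl⟩)

theorem lt_supConv_iff (h0 : (0 : Euc n) ∈ E) (hw : BddAbove (range w)) {x : Euc n} {t : ℝ} :
    t < supConv E h w x ↔ ∃ η ∈ E, t < w (x + h • η) := by
  have : Nonempty E := ⟨⟨0, h0⟩⟩
  rw [supConv, lt_ciSup_iff (bddAbove_range_supConv hw x)]
  simp

theorem le_supConv (h0 : (0 : Euc n) ∈ E) (hw : BddAbove (range w)) (x : Euc n) :
    w x ≤ supConv E h w x := by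
  have := le_ciSup (bddAbove_range_supConv (h := h) hw x) ⟨0, h0⟩
  simpa [supConv] using this

theorem isOpen_lt_supConv (h0 : (0 : Euc n) ∈ E) (hw : BddAbove (range w)) (hc : Continuous w)
    (t : ℝ) : IsOpen {x | t < supConv E h w x} := by
  have : {x | t < supConv E h w x} = ⋃ η ∈ E, {x | t < w (x + h • η)} := by
    ext x
    simp [lt_supConv_iff h0 hw]
  rw [this]
  exact isOpen_biUnion fun η _ => isOpen_lt continuous_const (by fun_prop)

theorem measurable_supConv (h0 : (0 : Euc n) ∈ E) (hw : BddAbove (range w)) (hc : Continuous w) :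
    Measurable (supConv E h w) :=
  measurable_of_Ioi fun t => (isOpen_lt_supConv h0 hw hc t).measurableSet

end SupConv

theorem lintegral_add_le_lintegral_supConv {n : ℕ} {E : Set (Euc n)} {c : ℝ}
    (h0 : (0 : Euc n) ∈ E) (hEm : MeasurableSet E) (hc : 0 < c)
    (hEc : volume E = ENNReal.ofReal (c ^ n)) {w : Euc n → ℝ} (hw : Continuous w)
    (hws : HasCompactSupport w) (hw0 : ∀ x, 0 ≤ w x) {a m h : ℝ} (hm : 0 < m)
    (hh : 0 < h) (hn : 1 ≤ n) (hvol : ENNReal.ofReal (m ^ n) ≤ volume {x | a < w x}) :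
    (∫⁻ x, ENNReal.ofReal (w x)) +
        ENNReal.ofReal a * ENNReal.ofReal (n * m ^ (n - 1) * (h * c)) ≤
      ∫⁻ x, ENNReal.ofReal (supConv E h w x) := by
  have hbd : BddAbove (range w) := (hws.isCompact_range hw).bddAbove
  have hn0 : n ≠ 0 := by omega
  rw [lintegral_eq_lintegral_meas_lt volume (Eventually.of_forall hw0) hw.measurable.aemeasurable,
    lintegral_eq_lintegral_meas_lt volume
      (Eventually.of_forall fun x => (hw0 x).trans (le_supConv h0 hbd x))
      (measurable_supConv h0 hbd hw).aemeasurable]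
  set q := ENNReal.ofReal (n * m ^ (n - 1) * (h * c))
  have e1 : ENNReal.ofReal a * q = ∫⁻ t in Ioi (0 : ℝ), (Iio a).indicator (fun _ => q) t := by
    rw [lintegral_indicator measurableSet_Iio, lintegral_const, Measure.restrict_restrict
      measurableSet_Iio, Measure.restrict_apply_univ, inter_comm, Ioi_inter_Iio,
      Real.volume_Ioo, sub_zero, mul_comm]
  rw [e1, ← lintegral_add_right _ (measurable_const.indicator measurableSet_Iio)]
  refine setLIntegral_mono' measurableSet_Ioi fun σ (hσ : 0 < σ) => ?_
  by_cases hσa : σ < a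
  · rw [indicator_of_mem (show σ ∈ Iio a from hσa)]
    have hfin : volume {x | σ < w x} ≠ ⊤ := by
      refine ((measure_mono ?_).trans_lt hws.measure_lt_top).ne
      intro x hx
      exact subset_tsupport _ (hσ.trans hx).ne'
    set x := (volume {x | σ < w x}).toReal ^ ((n : ℝ)⁻¹) with hx
    have hxn : volume {x | σ < w x} = ENNReal.ofReal (x ^ n) := by
      rw [hx, Real.rpow_inv_natCast_pow ENNReal.toReal_nonneg hn0, ENNReal.ofReal_toReal hfin]
    have hmx : m ≤ x := by
      have h1 : ENNReal.ofReal (m ^ n) ≤ ENNReal.ofReal (x ^ n) := by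
        rw [← hxn]
        exact hvol.trans (measure_mono fun y hy => hσa.trans hy)
      have hx0 : 0 ≤ x := by positivity
      rw [ENNReal.ofReal_le_ofReal_iff (by positivity)] at h1
      exact le_of_pow_le_pow_left₀ hn0 hx0 h1
    have hx0 : 0 < x := hm.trans_le hmx
    have hB : volume ((-h) • E) = ENNReal.ofReal ((h * c) ^ n) := by
      rw [Measure.addHaar_smul, hEc, finrank_euclideanSpace_fin,
        ← ENNReal.ofReal_mul (by positivity), abs_pow, abs_neg, abs_of_pos hh, mul_pow]
    have bm := brunn_minkowski (isOpen_lt continuous_const hw).measurableSet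
      (hEm.const_smul₀ (-h)) (isOpen_lt_supConv (h := h) h0 hbd hw σ).measurableSet
      (fun p hp b hb => by
        obtain ⟨η, hη, rfl⟩ := hb
        refine (lt_supConv_iff h0 hbd).2 ⟨η, hη, ?_⟩
        simpa using hp) hx0 (by positivity) hxn hB
    refine le_trans ?_ bm
    rw [hxn, ← ENNReal.ofReal_add (by positivity) (by positivity)]
    refine ENNReal.ofReal_le_ofReal ?_
    have h3 := pow_add_mul_le_add_pow hx0.le (b := h * c) (by positivity) n
    have h4 : (n : ℝ) * m ^ (n - 1) * (h * c) ≤ n * x ^ (n - 1) * (h * c) := by gcongr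
    linarith
  · rw [indicator_of_notMem (show σ ∉ Iio a from hσa), add_zero]
    exact measure_mono fun y hy => lt_of_lt_of_le hy (le_supConv h0 hbd y)

theorem exists_supConv_le {n : ℕ} {E : Set (Euc n)} {D : ℝ} (h0 : (0 : Euc n) ∈ E)
    (hD : E ⊆ Metric.closedBall 0 D)
    {H : Euc n → ℝ} (hH : ∀ ξ, ∀ η ∈ E, ⟪ξ, η⟫ ≤ H ξ)
    {w : Euc n → ℝ} (hw : ContDiff ℝ 1 w) (hws : HasCompactSupport w) {ε : ℝ} (hε : 0 < ε) :
    ∃ h : ℝ, 0 < h ∧ h ≤ 1 ∧ ∀ x, supConv E h w x ≤ w x + h * (H (gradient w x) + ε) := by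
  have hD0 : 0 ≤ D := by simpa using hD h0
  have : Nonempty E := ⟨⟨0, h0⟩⟩
  have uc := (hws.fderiv (𝕜 := ℝ)).uniformContinuous_of_continuous (hw.continuous_fderiv (by simp))
  obtain ⟨δ, hδ, hδ'⟩ := Metric.uniformContinuous_iff.1 uc (ε / (D + 1)) (by positivity)
  refine ⟨min 1 (δ / (2 * (D + 1))), by positivity, min_le_left _ _, fun x => ciSup_le ?_⟩
  rintro ⟨η, hη⟩
  set h := min 1 (δ / (2 * (D + 1))) with hh
  have hh0 : 0 < h := by positivity
  have hηD : ‖η‖ ≤ D := by simpa using hD hη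
  have hhD : h * (D + 1) < δ := by
    have : h ≤ δ / (2 * (D + 1)) := min_le_right _ _
    calc h * (D + 1) ≤ δ / (2 * (D + 1)) * (D + 1) := by gcongr
      _ = δ / 2 := by field_simp
      _ < δ := by linarith
  have hnorm : ‖h • η‖ ≤ h * D := by
    rw [norm_smul, Real.norm_of_nonneg hh0.le]; gcongr
  have mv := (convex_ball x δ).norm_image_sub_le_of_norm_fderiv_le' (𝕜 := ℝ) (f := w)
    (φ := fderiv ℝ w x) (C := ε / (D + 1)) (x := x) (y := x + h • η)
    (fun y _ => (hw.differentiable (by simp)).differentiableAt)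
    (fun y hy => by
      rw [← dist_eq_norm]
      exact (hδ' hy).le) (Metric.mem_ball_self hδ) (by
      rw [Metric.mem_ball, dist_eq_norm, add_sub_cancel_left]
      nlinarith)
  rw [add_sub_cancel_left, map_smul, smul_eq_mul, ← inner_gradient_left] at mv
  have m1 := (le_abs_self _).trans mv
  have m2 : ε / (D + 1) * ‖h • η‖ ≤ h * ε := by
    calc ε / (D + 1) * ‖h • η‖ ≤ ε / (D + 1) * (h * (D + 1)) := by gcongr; nlinarith
      _ = h * ε := by field_simp
  have m3 : h * ⟪gradient w x, η⟫ ≤ h * H (gradient w x) := by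
    gcongr
    exact hH _ _ hη
  linarith

theorem isoperimetric_of_contDiff {n : ℕ} (hn : 1 ≤ n) {E : Set (Euc n)} {c D : ℝ}
    (h0 : (0 : Euc n) ∈ E) (hEm : MeasurableSet E) (hD : E ⊆ Metric.closedBall 0 D) (hc : 0 < c)
    (hEc : volume E = ENNReal.ofReal (c ^ n)) {H : Euc n → ℝ}
    (hH : ∀ ξ, ∀ η ∈ E, ⟪ξ, η⟫ ≤ H ξ)
    {w : Euc n → ℝ} (hw : ContDiff ℝ 1 w) (hws : HasCompactSupport w) (hw0 : ∀ x, 0 ≤ w x)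
    {a m : ℝ} (hm : 0 < m) (hvol : ENNReal.ofReal (m ^ n) ≤ volume {x | a < w x}) :
    ENNReal.ofReal a * ENNReal.ofReal (n * m ^ (n - 1) * c) ≤
      ∫⁻ x, ENNReal.ofReal (H (gradient w x)) := by
  have hbd : BddAbove (range w) := (hws.isCompact_range hw.continuous).bddAbove
  have hH0 : ∀ ξ, 0 ≤ H ξ := fun ξ => by simpa using hH ξ 0 h0
  set S := Metric.cthickening D (tsupport w)
  have hSc : IsCompact S := hws.isCompact.cthickening
  have hSfin : volume S ≠ ⊤ := hSc.measure_lt_top.ne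
  have hwfin : (∫⁻ x, ENNReal.ofReal (w x)) ≠ ⊤ :=
    (hw.continuous.integrable_of_hasCompactSupport hws).lintegral_lt_top.ne
  refine ENNReal.le_of_forall_pos_le_add fun ε' hε' _ => ?_
  set ε : ℝ := ε' / ((volume S).toReal + 1) with hε_def
  have hε : 0 < ε := by positivity
  obtain ⟨h, hh, hh1, hle⟩ := exists_supConv_le h0 hD hH hw hws hε
  have key := lintegral_add_le_lintegral_supConv h0 hEm hc hEc hw.continuous hws hw0 hm hh hn hvol
  have hpt : ∀ x, ENNReal.ofReal (supConv E h w x) ≤ ENNReal.ofReal (w x) +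
      ENNReal.ofReal h * (ENNReal.ofReal (H (gradient w x)) +
        S.indicator (fun _ => ENNReal.ofReal ε) x) := by
    intro x
    by_cases hx : x ∈ S
    · rw [indicator_of_mem hx, ← ENNReal.ofReal_add (hH0 _) hε.le, ← ENNReal.ofReal_mul hh.le,
        ← ENNReal.ofReal_add (hw0 _) (mul_nonneg hh.le (add_nonneg (hH0 _) hε.le))]
      exact ENNReal.ofReal_le_ofReal (hle x)
    · have : supConv E h w x ≤ 0 := by
        have : Nonempty E := ⟨⟨0, h0⟩⟩
        refine ciSup_le ?_
        rintro ⟨η, hη⟩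
        by_contra hcon
        refine hx (Metric.mem_cthickening_of_dist_le x (x + h • η) D _
          (subset_tsupport _ (fun h' => hcon h'.le)) ?_)
        have hηD : ‖η‖ ≤ D := by simpa using hD hη
        rw [dist_eq_norm, sub_add_cancel_left, norm_neg, norm_smul, Real.norm_of_nonneg hh.le]
        nlinarith [norm_nonneg η]
      rw [ENNReal.ofReal_of_nonpos this]
      exact zero_le
  have hSm : MeasurableSet S := hSc.isClosed.measurableSet
  have hwm : Measurable fun x => ENNReal.ofReal (w x) := hw.continuous.measurable.ennreal_ofReal
  have key2 := key.trans (lintegral_mono hpt)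
  rw [lintegral_add_left hwm, ENNReal.add_le_add_iff_left hwfin,
    lintegral_const_mul' _ _ ENNReal.ofReal_ne_top,
    lintegral_add_right _ (measurable_const.indicator hSm), lintegral_indicator_const hSm] at key2
  have e : ENNReal.ofReal a * ENNReal.ofReal (n * m ^ (n - 1) * (h * c)) =
      ENNReal.ofReal h * (ENNReal.ofReal a * ENNReal.ofReal (n * m ^ (n - 1) * c)) := by
    rw [mul_left_comm (ENNReal.ofReal h), ← ENNReal.ofReal_mul hh.le]
    congr 2
    ring
  rw [e, ENNReal.mul_le_mul_iff_right (by simpa using hh) ENNReal.ofReal_ne_top] at key2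
  refine key2.trans (add_le_add_right ?_ _)
  rw [← ENNReal.ofReal_toReal hSfin, ← ENNReal.ofReal_mul hε.le, ← ENNReal.ofReal_coe_nnreal]
  refine ENNReal.ofReal_le_ofReal ?_
  rw [hε_def, div_mul_eq_mul_div, div_le_iff₀ (by positivity)]
  have : (0 : ℝ) ≤ ε' := ε'.2
  nlinarith [ENNReal.toReal_nonneg (a := volume S)]

section SupportFunction

variable {n : ℕ} {E : Set (Euc n)} {D : ℝ}

theorem inner_le_suppFnR (hD : E ⊆ Metric.closedBall 0 D) (ξ : Euc n) {η : Euc n} (hη : η ∈ E) :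
    ⟪ξ, η⟫ ≤ suppFnR E ξ := by
  refine le_csSup ⟨‖ξ‖ * D, ?_⟩ (mem_image_of_mem _ hη)
  rintro _ ⟨η, hη, rfl⟩
  refine (real_inner_le_norm ξ η).trans ?_
  gcongr
  simpa using hD hη

theorem suppFnR_le (hE : E.Nonempty) {ξ : Euc n} {a : ℝ} (h : ∀ η ∈ E, ⟪ξ, η⟫ ≤ a) :
    suppFnR E ξ ≤ a := by
  refine csSup_le (hE.image _) ?_
  rintro _ ⟨η, hη, rfl⟩
  exact h η hη

theorem suppFnR_nonneg (hD : E ⊆ Metric.closedBall 0 D) (h0 : (0 : Euc n) ∈ E) (ξ : Euc n) :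
    0 ≤ suppFnR E ξ := by
  simpa using inner_le_suppFnR hD ξ h0

theorem suppFnR_add_le (hD : E ⊆ Metric.closedBall 0 D) (hE : E.Nonempty) (ξ ζ : Euc n) :
    suppFnR E (ξ + ζ) ≤ suppFnR E ξ + suppFnR E ζ := by
  refine suppFnR_le hE fun η hη => ?_
  rw [inner_add_left]
  exact add_le_add (inner_le_suppFnR hD _ hη) (inner_le_suppFnR hD _ hη)

theorem suppFnR_smul_le (hD : E ⊆ Metric.closedBall 0 D) (hE : E.Nonempty) {r : ℝ} (hr : 0 ≤ r)
    (ξ : Euc n) : suppFnR E (r • ξ) ≤ r * suppFnR E ξ := by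
  refine suppFnR_le hE fun η hη => ?_
  rw [real_inner_smul_left]
  exact mul_le_mul_of_nonneg_left (inner_le_suppFnR hD _ hη) hr

theorem suppFnR_le_mul_norm (hD : E ⊆ Metric.closedBall 0 D) (hE : E.Nonempty) (ξ : Euc n) :
    suppFnR E ξ ≤ D * ‖ξ‖ := by
  refine suppFnR_le hE fun η hη => (real_inner_le_norm ξ η).trans ?_
  rw [mul_comm]
  gcongr
  simpa using hD hη

theorem continuous_suppFnR (hD : E ⊆ Metric.closedBall 0 D) (hE : E.Nonempty) :
    Continuous (suppFnR E) := by
  have hD0 : 0 ≤ D := by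
    obtain ⟨η, hη⟩ := hE
    exact (norm_nonneg η).trans (by simpa using hD hη)
  refine (LipschitzWith.of_le_add_mul D.toNNReal fun x y => ?_).continuous
  have h1 := suppFnR_add_le hD hE y (x - y)
  have h2 := suppFnR_le_mul_norm hD hE (x - y)
  rw [add_sub_cancel] at h1
  rw [Real.coe_toNNReal _ hD0, dist_eq_norm]
  linarith

end SupportFunction

section Mollification

open ContinuousLinearMap
open scoped Convolution

variable {n : ℕ} {u : Euc n → ℝ} {g : Euc n → Euc n}

theorem HasWeakGradient.gradient_convolution (hu : HasWeakGradient u g)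
    (φ : ContDiffBump (0 : Euc n)) (x : Euc n) :
    gradient (φ.normed volume ⋆[lsmul ℝ ℝ, volume] u) x =
      (φ.normed volume ⋆[lsmul ℝ ℝ, volume] g) x := by
  set ρ := φ.normed volume
  have hρs : HasCompactSupport ρ := φ.hasCompactSupport_normed
  have hρc : ContDiff ℝ (⊤ : ℕ∞) ρ := φ.contDiff_normed
  refine ext_inner_right ℝ fun v => ?_
  rw [inner_gradient_left,
    (hρs.hasFDerivAt_convolution_left (lsmul ℝ ℝ) (hρc.of_le (by simp)) hu.1 x).fderiv]
  have hφ : ContDiff ℝ (⊤ : ℕ∞) fun t => ρ (x - t) := hρc.comp (by fun_prop)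
  have hφs : HasCompactSupport fun t => ρ (x - t) :=
    hρs.comp_homeomorph (Homeomorph.subLeft x)
  have key := hu.2.2 _ hφ hφs v
  have hd : ∀ t, fderiv ℝ (fun t => ρ (x - t)) t v = - fderiv ℝ ρ (x - t) v := by
    intro t
    have h1 : HasFDerivAt ρ (fderiv ℝ ρ (x - t)) (x - t) :=
      ((hρc.differentiable (by simp)) _).hasFDerivAt
    have h2 : HasFDerivAt (fun t => x - t) (-ContinuousLinearMap.id ℝ (Euc n)) t :=
      (hasFDerivAt_id t).const_sub x
    have h3 := (h1.comp t h2).fderiv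
    rw [show (ρ ∘ fun t => x - t) = fun t => ρ (x - t) from rfl] at h3
    rw [h3]
    simp
  have i1 : Integrable fun t => (precompL (Euc n) (lsmul ℝ ℝ : ℝ →L[ℝ] ℝ →L[ℝ] ℝ))
      (fderiv ℝ ρ (x - t)) (u t) := by
    have := (hρs.fderiv (𝕜 := ℝ)).convolutionExists_left
      (precompL (Euc n) (lsmul ℝ ℝ : ℝ →L[ℝ] ℝ →L[ℝ] ℝ))
      (hρc.continuous_fderiv (by simp)) hu.1 x
    exact this.integrable_swap
  have i2 : Integrable fun t => ρ (x - t) • g t := by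
    have := hρs.convolutionExists_left (lsmul ℝ ℝ : ℝ →L[ℝ] (Euc n) →L[ℝ] (Euc n))
      hρc.continuous hu.2.1 x
    exact this.integrable_swap
  rw [convolution_eq_swap, convolution_eq_swap, ContinuousLinearMap.integral_apply i1,
    show (∫ t, lsmul ℝ ℝ (ρ (x - t)) (g t)) = ∫ t, ρ (x - t) • g t from rfl,
    real_inner_comm, ← integral_inner i2 v]
  simp only [hd, mul_neg, integral_neg, neg_inj] at key
  simp only [precompL_apply, lsmul_apply, real_inner_smul_right, smul_eq_mul]
  calc _ = ∫ t, u t * fderiv ℝ ρ (x - t) v := by simp_rw [mul_comm]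
    _ = _ := by
      rw [key]
      congr 1 with t
      rw [real_inner_comm, mul_comm]

theorem suppFnR_convolution_le {E : Set (Euc n)} {D : ℝ} (hD : E ⊆ Metric.closedBall 0 D)
    (h0 : (0 : Euc n) ∈ E) (hg : LocallyIntegrable g) (φ : ContDiffBump (0 : Euc n)) (x : Euc n) :
    ENNReal.ofReal (suppFnR E ((φ.normed volume ⋆[lsmul ℝ ℝ, volume] g) x)) ≤
      ∫⁻ t, ENNReal.ofReal (φ.normed volume t) * ENNReal.ofReal (suppFnR E (g (x - t))) := by
  set ρ := φ.normed volume
  have hρ0 : ∀ t, 0 ≤ ρ t := φ.nonneg_normed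
  have hcont := continuous_suppFnR hD ⟨0, h0⟩
  have i2 : Integrable fun t => ρ t • g (x - t) :=
    φ.hasCompactSupport_normed.convolutionExists_left (lsmul ℝ ℝ : ℝ →L[ℝ] (Euc n) →L[ℝ] (Euc n))
      φ.continuous_normed hg x
  have hm : AEStronglyMeasurable (fun t => g (x - t)) volume :=
    hg.aestronglyMeasurable.comp_quasiMeasurePreserving
      (quasiMeasurePreserving_sub_left volume x)
  have i3 : Integrable fun t => ρ t * suppFnR E (g (x - t)) := by
    refine (i2.norm.const_mul D).mono' (φ.continuous_normed.aestronglyMeasurable.mul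
      (hcont.comp_aestronglyMeasurable hm)) (Eventually.of_forall fun t => ?_)
    rw [Real.norm_of_nonneg (mul_nonneg (hρ0 t) (suppFnR_nonneg hD h0 _)), norm_smul,
      Real.norm_of_nonneg (hρ0 t), mul_left_comm]
    exact mul_le_mul_of_nonneg_left (suppFnR_le_mul_norm hD ⟨0, h0⟩ _) (hρ0 t)
  have e : (∫⁻ t, ENNReal.ofReal (ρ t) * ENNReal.ofReal (suppFnR E (g (x - t)))) =
      ENNReal.ofReal (∫ t, ρ t * suppFnR E (g (x - t))) := by
    rw [ofReal_integral_eq_lintegral_ofReal i3 (Eventually.of_forall fun t =>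
      mul_nonneg (hρ0 t) (suppFnR_nonneg hD h0 _))]
    simp_rw [ENNReal.ofReal_mul (hρ0 _)]
  rw [e]
  refine ENNReal.ofReal_le_ofReal (suppFnR_le ⟨0, h0⟩ fun η hη => ?_)
  rw [convolution_lsmul, real_inner_comm, ← integral_inner i2 η]
  refine integral_mono (i2.const_inner η) i3 fun t => ?_
  simp only [real_inner_smul_right]
  rw [real_inner_comm]
  exact mul_le_mul_of_nonneg_left (inner_le_suppFnR hD _ hη) (hρ0 t)

theorem lintegral_suppFnR_convolution_le {E : Set (Euc n)} {D : ℝ}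
    (hD : E ⊆ Metric.closedBall 0 D)
    (h0 : (0 : Euc n) ∈ E) (hg : LocallyIntegrable g) (φ : ContDiffBump (0 : Euc n)) (R : ℝ) :
    (∫⁻ x in Metric.closedBall 0 R,
      ENNReal.ofReal (suppFnR E ((φ.normed volume ⋆[lsmul ℝ ℝ, volume] g) x))) ≤
      ∫⁻ x in Metric.closedBall 0 (R + φ.rOut), ENNReal.ofReal (suppFnR E (g x)) := by
  set ρ := φ.normed volume
  have hρ0 : ∀ t, 0 ≤ ρ t := φ.nonneg_normed
  have hcont := continuous_suppFnR hD ⟨0, h0⟩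
  set k : Euc n → ℝ≥0∞ := fun x => ENNReal.ofReal (suppFnR E (g x))
  have hk : AEMeasurable k volume :=
    (hcont.comp_aestronglyMeasurable hg.aestronglyMeasurable).aemeasurable.ennreal_ofReal
  calc _ ≤ ∫⁻ x in Metric.closedBall 0 R, ∫⁻ t, ENNReal.ofReal (ρ t) * k (x - t) :=
        lintegral_mono fun x => suppFnR_convolution_le hD h0 hg φ x
    _ = ∫⁻ t, ∫⁻ x in Metric.closedBall 0 R, ENNReal.ofReal (ρ t) * k (x - t) := by
        refine lintegral_lintegral_swap ?_
        change AEMeasurable (fun p : Euc n × Euc n => ENNReal.ofReal (ρ p.2) * k (p.1 - p.2)) _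
        refine AEMeasurable.mul (M := ℝ≥0∞) ?_ ?_
        · exact (φ.continuous_normed.measurable.ennreal_ofReal.comp measurable_snd).aemeasurable
        · refine AEMeasurable.comp_quasiMeasurePreserving hk
            (f := fun p : Euc n × Euc n => p.1 - p.2) ?_
          exact (quasiMeasurePreserving_sub_of_right_invariant volume volume).mono_left
            (Measure.AbsolutelyContinuous.prod Measure.absolutelyContinuous_restrict
              Measure.AbsolutelyContinuous.rfl)
    _ ≤ ∫⁻ t, ENNReal.ofReal (ρ t) * ∫⁻ x in Metric.closedBall 0 (R + φ.rOut), k x := by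
        refine lintegral_mono fun t => ?_
        rw [lintegral_const_mul' _ _ ENNReal.ofReal_ne_top]
        by_cases ht : t ∈ Metric.ball (0 : Euc n) φ.rOut
        · refine mul_le_mul_of_nonneg_left ?_ zero_le
          rw [← lintegral_indicator Metric.isClosed_closedBall.measurableSet,
            ← lintegral_indicator Metric.isClosed_closedBall.measurableSet,
            ← lintegral_sub_right_eq_self ((Metric.closedBall 0 (R + φ.rOut)).indicator k) t]
          refine lintegral_mono fun x => ?_
          by_cases hx : x ∈ Metric.closedBall (0 : Euc n) R
          · have : x - t ∈ Metric.closedBall (0 : Euc n) (R + φ.rOut) := by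
              simp only [Metric.mem_closedBall, dist_zero_right, Metric.mem_ball] at *
              exact (norm_sub_le _ _).trans (by linarith)
            rw [indicator_of_mem hx, indicator_of_mem this]
          · rw [indicator_of_notMem hx]
            exact zero_le
        · have : ρ t = 0 := by
            rw [← φ.support_normed_eq (μ := volume)] at ht
            simpa using ht
          simp [this]
    _ = ∫⁻ x in Metric.closedBall 0 (R + φ.rOut), k x := by
        rw [lintegral_mul_const _ φ.continuous_normed.measurable.ennreal_ofReal,
          ← ofReal_integral_eq_lintegral_ofReal φ.integrable_normed
            (Eventually.of_forall hρ0), φ.integral_normed, ENNReal.ofReal_one, one_mul]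

/-- Smooth approximation of a weakly differentiable function. -/
theorem HasWeakGradient.exists_approx (hu : HasWeakGradient u g) {E : Set (Euc n)} {D : ℝ}
    (hD : E ⊆ Metric.closedBall 0 D) (h0 : (0 : Euc n) ∈ E) :
    ∃ U : ℕ → Euc n → ℝ, (∀ j, ContDiff ℝ 1 (U j)) ∧
      (∀ᵐ x, Tendsto (fun j => U j x) atTop (𝓝 (u x))) ∧
      (∀ᵐ x, Tendsto (fun j => gradient (U j) x) atTop (𝓝 (g x))) ∧
      ∀ j R, (∫⁻ x in Metric.closedBall 0 R, ENNReal.ofReal (suppFnR E (gradient (U j) x))) ≤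
        ∫⁻ x in Metric.closedBall 0 (R + 2 * (1 / ((j : ℝ) + 1))),
          ENNReal.ofReal (suppFnR E (g x)) := by
  let φ : ℕ → ContDiffBump (0 : Euc n) := fun j =>
    { rIn := 1 / ((j : ℝ) + 1)
      rOut := 2 * (1 / ((j : ℝ) + 1))
      rIn_pos := by positivity
      rIn_lt_rOut := by
        have : 0 < 1 / ((j : ℝ) + 1) := by positivity
        linarith }
  have hφ : Tendsto (fun j => (φ j).rOut) atTop (𝓝 0) := by
    have := (tendsto_one_div_add_atTop_nhds_zero_nat (𝕜 := ℝ)).const_mul 2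
    rwa [mul_zero] at this
  have hφ' : ∀ᶠ j in atTop, (φ j).rOut ≤ 2 * (φ j).rIn := Eventually.of_forall fun j => le_rfl
  refine ⟨fun j => (φ j).normed volume ⋆[lsmul ℝ ℝ, volume] u, fun j => ?_, ?_, ?_, fun j R => ?_⟩
  · exact (φ j).hasCompactSupport_normed.contDiff_convolution_left _ (φ j).contDiff_normed hu.1
  · exact ContDiffBump.ae_convolution_tendsto_right_of_locallyIntegrable hφ hφ' hu.1
  · simp_rw [hu.gradient_convolution]
    exact ContDiffBump.ae_convolution_tendsto_right_of_locallyIntegrable hφ hφ' hu.2.1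
  · simp_rw [hu.gradient_convolution]
    exact lintegral_suppFnR_convolution_le hD h0 hu.2.1 (φ j) R

end Mollification

theorem exists_contDiff_truncation {s t l : ℝ} (hst : s < t) (hl : l < t - s) :
    ∃ (F : ℝ → ℝ) (I : ℝ), l < I ∧ I ≤ t - s ∧ ContDiff ℝ 1 F ∧
      (∀ y, 0 ≤ deriv F y) ∧ (∀ y, deriv F y ≤ 1) ∧ (∀ y, y ∉ Ioo s t → deriv F y = 0) ∧
      (∀ y, y ≤ s → F y = 0) ∧ (∀ y, t ≤ y → F y = I) ∧ (∀ y, 0 ≤ F y) ∧ ∀ y, F y ≤ I := by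
  obtain ⟨δ, hδ, hδl, hδ2⟩ : ∃ δ : ℝ, 0 < δ ∧ l < t - s - 2 * δ ∧ s + δ ≤ t - δ := by
    refine ⟨min ((t - s - l) / 4) ((t - s) / 2), ?_, ?_, ?_⟩
    · exact lt_min (by linarith) (by linarith)
    · have := min_le_left ((t - s - l) / 4) ((t - s) / 2)
      linarith
    · have := min_le_right ((t - s - l) / 4) ((t - s) / 2)
      linarith
  obtain ⟨ψ, hψ0, hψ1, hψ⟩ := exists_continuous_zero_one_of_isClosed (X := ℝ)
    (s := (Ioo s t)ᶜ) (t := Icc (s + δ) (t - δ)) isOpen_Ioo.isClosed_compl isClosed_Icc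
    (by
      rw [Set.disjoint_left]
      intro x hx hx'
      exact hx ⟨by linarith [hx'.1], by linarith [hx'.2]⟩)
  have hci : ∀ a b : ℝ, IntervalIntegrable ψ volume a b := fun a b =>
    ψ.continuous.intervalIntegrable a b
  have hd : ∀ y, HasDerivAt (fun y => ∫ r in s..y, ψ r) (ψ y) y := fun y =>
    intervalIntegral.integral_hasDerivAt_right (hci _ _)
      (ψ.continuous.stronglyMeasurableAtFilter _ _) ψ.continuous.continuousAt
  have hde : deriv (fun y => ∫ r in s..y, ψ r) = ψ := funext fun y => (hd y).deriv
  have hmono : Monotone fun y => ∫ r in s..y, ψ r :=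
    monotone_of_deriv_nonneg (fun y => (hd y).differentiableAt) fun y => by
      rw [hde]; exact (hψ y).1
  have hz : ∀ y, y ≤ s → (∫ r in s..y, ψ r) = 0 := fun y hy => by
    refine intervalIntegral.integral_zero_ae (Eventually.of_forall fun r hr => hψ0 ?_)
    rw [uIoc_of_ge hy] at hr
    exact fun h => absurd h.1 (not_lt.2 hr.2)
  have ht : ∀ y, t ≤ y → (∫ r in s..y, ψ r) = ∫ r in s..t, ψ r := fun y hy => by
    rw [← intervalIntegral.integral_add_adjacent_intervals (hci s t) (hci t y)]
    simp only [add_eq_left]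
    refine intervalIntegral.integral_zero_ae (Eventually.of_forall fun r hr => hψ0 ?_)
    rw [uIoc_of_le hy] at hr
    exact fun h => absurd h.2 (not_lt.2 hr.1.le)
  refine ⟨fun y => ∫ r in s..y, ψ r, ∫ r in s..t, ψ r, ?_, ?_, ?_, ?_, ?_, ?_, hz, ht, ?_, ?_⟩
  · have h1 : (∫ r in (s + δ)..(t - δ), ψ r) = t - δ - (s + δ) := by
      rw [← intervalIntegral.integral_congr (f := fun _ => (1 : ℝ))]
      · simp
      · intro r hr
        rw [uIcc_of_le hδ2] at hr
        exact (hψ1 hr).symm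
    have h2 : (∫ r in (s + δ)..(t - δ), ψ r) ≤ ∫ r in s..t, ψ r :=
      intervalIntegral.integral_mono_interval (by linarith) hδ2 (by linarith)
        (Eventually.of_forall fun r => (hψ r).1) (hci _ _)
    linarith
  · have := intervalIntegral.integral_mono_on hst.le (hci s t)
      (intervalIntegrable_const (c := (1 : ℝ))) fun r _ => (hψ r).2
    simpa using this
  · rw [contDiff_one_iff_deriv]
    exact ⟨fun y => (hd y).differentiableAt, by rw [hde]; exact ψ.continuous⟩
  · intro y; rw [hde]; exact (hψ y).1
  · intro y; rw [hde]; exact (hψ y).2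
  · intro y hy; rw [hde]; exact hψ0 hy
  · intro y
    rcases le_total y s with h | h
    · exact (hz y h).ge
    · exact (hz s le_rfl).ge.trans (hmono h)
  · intro y
    rcases le_total y t with h | h
    · exact hmono h
    · exact (ht y h).le

theorem exists_contDiff_cutoff (n : ℕ) : ∃ C : ℝ, 0 ≤ C ∧ ∀ R : ℝ, 0 < R →
    ∃ χ : Euc n → ℝ, ContDiff ℝ 1 χ ∧ (∀ x, 0 ≤ χ x) ∧ (∀ x, χ x ≤ 1) ∧
      (∀ x ∈ Metric.closedBall (0 : Euc n) R, χ x = 1) ∧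
      tsupport χ ⊆ Metric.closedBall 0 (2 * R) ∧ ∀ x, ‖gradient χ x‖ ≤ C / R := by
  let b : ContDiffBump (0 : Euc n) := ⟨1, 2, one_pos, one_lt_two⟩
  obtain ⟨C, hC⟩ := (b.hasCompactSupport.fderiv (𝕜 := ℝ)).exists_bound_of_continuous
    ((b.contDiff (n := 1)).continuous_fderiv (by simp))
  refine ⟨C, (norm_nonneg _).trans (hC 0), fun R hR => ⟨fun x => b (R⁻¹ • x),
    b.contDiff.comp (contDiff_const_smul _), fun x => b.nonneg, fun x => b.le_one, ?_, ?_, ?_⟩⟩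
  · intro x hx
    refine b.one_of_mem_closedBall ?_
    simp only [Metric.mem_closedBall, dist_zero_right, norm_smul, norm_inv,
      Real.norm_of_nonneg hR.le] at *
    rw [inv_mul_le_iff₀ hR]
    simpa [b] using hx
  · refine closure_minimal ?_ Metric.isClosed_closedBall
    intro x hx
    have h1 : R⁻¹ • x ∈ Function.support b := hx
    rw [b.support_eq] at h1
    simp only [Metric.mem_closedBall, Metric.mem_ball, dist_zero_right, norm_smul, norm_inv,
      Real.norm_of_nonneg hR.le] at *
    rw [inv_mul_lt_iff₀ hR] at h1
    have : b.rOut = 2 := rfl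
    nlinarith
  · intro x
    have hd : HasFDerivAt (fun x => b (R⁻¹ • x))
        ((fderiv ℝ b (R⁻¹ • x)).comp (R⁻¹ • ContinuousLinearMap.id ℝ (Euc n))) x := by
      have h1 : HasFDerivAt b (fderiv ℝ b (R⁻¹ • x)) (R⁻¹ • x) :=
        (((b.contDiff (n := 1)).differentiable (by simp)) _).hasFDerivAt
      exact h1.comp x ((hasFDerivAt_id x).const_smul R⁻¹)
    rw [gradient, LinearIsometryEquiv.norm_map, hd.fderiv]
    simp only [ContinuousLinearMap.comp_smul, ContinuousLinearMap.comp_id, norm_smul, norm_inv,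
      Real.norm_of_nonneg hR.le]
    rw [div_eq_inv_mul]
    gcongr
    exact hC _

theorem eventually_lintegral_mul_le {α : Type*} [MeasurableSpace α] {μ : Measure α}
    {a : ℕ → α → ℝ≥0∞} {k : ℕ → α → ℝ≥0∞} {a' k' : α → ℝ≥0∞}
    (ham : ∀ j, AEMeasurable (a j) μ) (ham' : AEMeasurable a' μ)
    (hkm : ∀ j, AEMeasurable (k j) μ) (ha1 : ∀ j x, a j x ≤ 1) (ha1' : ∀ x, a' x ≤ 1)
    (hk : ∀ x, k' x ≠ ⊤)
    (ha : ∀ᵐ x ∂μ, Tendsto (fun j => a j x) atTop (𝓝 (a' x)))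
    (hkt : ∀ᵐ x ∂μ, Tendsto (fun j => k j x) atTop (𝓝 (k' x)))
    (hkf : ∫⁻ x, k' x ∂μ ≠ ⊤)
    (hle : ∀ δ : ℝ≥0∞, δ ≠ 0 → ∀ᶠ j in atTop, ∫⁻ x, k j x ∂μ ≤ (∫⁻ x, k' x ∂μ) + δ)
    {δ : ℝ≥0∞} (hδ : δ ≠ 0) :
    ∀ᶠ j in atTop, ∫⁻ x, a j x * k j x ∂μ ≤ (∫⁻ x, a' x * k' x ∂μ) + δ := by
  rcases eq_or_ne δ ⊤ with rfl | hδt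
  · simp
  have hsplit : ∀ (p q : α → ℝ≥0∞), AEMeasurable p μ → AEMeasurable q μ → (∀ x, p x ≤ 1) →
      ∫⁻ x, q x ∂μ = (∫⁻ x, p x * q x ∂μ) + ∫⁻ x, (1 - p x) * q x ∂μ := by
    intro p q hp hq hp1
    rw [← lintegral_add_left' (show AEMeasurable (fun x => p x * q x) μ from hp.mul hq)]
    refine lintegral_congr fun x => ?_
    rw [← add_mul, add_tsub_cancel_of_le (hp1 x), one_mul]
  have hkm' : AEMeasurable k' μ := aemeasurable_of_tendsto_metrizable_ae _ hkm hkt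
  have fatou : (∫⁻ x, (1 - a' x) * k' x ∂μ) ≤
      liminf (fun j => ∫⁻ x, (1 - a j x) * k j x ∂μ) atTop := by
    refine le_trans (lintegral_mono_ae ?_) (lintegral_liminf_le' fun j =>
      (aemeasurable_const.sub (ham j)).mul (hkm j))
    filter_upwards [ha, hkt] with x hx hx'
    refine (Tendsto.liminf_eq ?_).ge
    refine ENNReal.Tendsto.mul (ENNReal.Tendsto.sub tendsto_const_nhds hx (Or.inl (by simp)))
      (Or.inr (hk x)) hx' (Or.inr ?_)
    exact (tsub_le_self.trans_lt ENNReal.one_lt_top).ne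
  set Y := ∫⁻ x, (1 - a' x) * k' x ∂μ
  have hY : Y ≠ ⊤ := by
    refine ne_top_of_le_ne_top hkf ?_
    rw [hsplit a' k' ham' hkm' ha1']
    exact le_add_self
  have hev : ∀ᶠ j in atTop, Y ≤ (∫⁻ x, (1 - a j x) * k j x ∂μ) + δ / 2 := by
    rcases eq_or_ne Y 0 with h0 | h0
    · simp [h0]
    · have : Y - δ / 2 < liminf (fun j => ∫⁻ x, (1 - a j x) * k j x ∂μ) atTop :=
        (ENNReal.sub_lt_self hY h0 (ENNReal.half_pos hδ).ne').trans_le fatou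
      filter_upwards [eventually_lt_of_lt_liminf this] with j hj
      exact tsub_le_iff_right.1 hj.le
  filter_upwards [hev, hle (δ / 2) (ENNReal.half_pos hδ).ne'] with j h1 h2
  rw [hsplit a' k' ham' hkm' ha1', hsplit (a j) (k j) (ham j) (hkm j) (ha1 j)] at h2
  have hfin : ∫⁻ x, (1 - a j x) * k j x ∂μ ≠ ⊤ := by
    refine ne_top_of_le_ne_top ?_ (le_add_self.trans h2)
    rw [← hsplit a' k' ham' hkm' ha1']
    exact ENNReal.add_ne_top.2 ⟨hkf, (ENNReal.div_lt_top hδt (by simp)).ne⟩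
  refine (ENNReal.add_le_add_iff_right hfin).1 (h2.trans ?_)
  calc _ ≤ (∫⁻ x, a' x * k' x ∂μ) + ((∫⁻ x, (1 - a j x) * k j x ∂μ) + δ / 2) + δ / 2 := by
        gcongr
    _ = (∫⁻ x, a' x * k' x ∂μ) + (∫⁻ x, (1 - a j x) * k j x ∂μ) + (δ / 2 + δ / 2) := by ring
    _ = _ := by rw [ENNReal.add_halves]; ring

theorem exists_le_measure_of_ae_eventually {α : Type*} [MeasurableSpace α] {μ : Measure α}
    {T : Set α} {S : ℕ → Set α} (h : ∀ᵐ x ∂μ, x ∈ T → ∀ᶠ j in atTop, x ∈ S j) {b : ℝ≥0∞}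
    (hb : b < μ T) : ∀ᶠ j in atTop, b ≤ μ (S j) := by
  set V : ℕ → Set α := fun N => ⋂ j ≥ N, S j
  have hV : Monotone V := fun N M hNM =>
    biInter_subset_biInter_left fun j (hj : M ≤ j) => hNM.trans hj
  have hT : μ T ≤ μ (⋃ N, V N) := by
    refine measure_mono_ae ?_
    filter_upwards [h] with x hx hxT
    obtain ⟨N, hN⟩ := eventually_atTop.1 (hx hxT)
    exact mem_iUnion.2 ⟨N, mem_iInter₂.2 hN⟩
  have ht := tendsto_measure_iUnion_atTop (μ := μ) hV
  obtain ⟨N, hN⟩ := eventually_atTop.1 (ht.eventually (lt_mem_nhds (hb.trans_le hT)))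
  filter_upwards [eventually_ge_atTop N] with j hj
  exact (hN N le_rfl).le.trans (measure_mono (biInter_subset_of_mem hj))

theorem tendsto_setLIntegral_closedBall {n : ℕ} {k : Euc n → ℝ≥0∞}
    (hfin : ∀ R, (∫⁻ x in Metric.closedBall 0 R, k x) ≠ ⊤) {R : ℝ} (hR : 0 ≤ R) {r : ℕ → ℝ}
    (hr0 : ∀ j, 0 ≤ r j) (hr : Tendsto r atTop (𝓝 0)) :
    Tendsto (fun j => ∫⁻ x in Metric.closedBall 0 (R + r j), k x) atTop
      (𝓝 (∫⁻ x in Metric.closedBall 0 R, k x)) := by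
  have hm : ∀ R : ℝ, MeasurableSet (Metric.closedBall (0 : Euc n) R) := fun R =>
    Metric.isClosed_closedBall.measurableSet
  simp_rw [← withDensity_apply k (hm _)] at hfin ⊢
  have h := tendsto_measure_cthickening_of_isClosed (μ := volume.withDensity k)
    (s := Metric.closedBall (0 : Euc n) R)
    ⟨1, one_pos, by rw [cthickening_closedBall zero_le_one hR]; exact hfin _⟩
    Metric.isClosed_closedBall
  refine (h.comp hr).congr fun j => ?_
  simp only [Function.comp_apply]
  rw [cthickening_closedBall (hr0 j) hR, add_comm]

section Strip

variable {n : ℕ} {E : Set (Euc n)} {D c : ℝ}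

theorem isoperimetric_truncation (hn : 1 ≤ n) (h0 : (0 : Euc n) ∈ E) (hEm : MeasurableSet E)
    (hD : E ⊆ Metric.closedBall 0 D) (hc : 0 < c) (hEc : volume E = ENNReal.ofReal (c ^ n))
    {U χ : Euc n → ℝ} {F : ℝ → ℝ} (hU : ContDiff ℝ 1 U) (hF : ContDiff ℝ 1 F)
    (hF0 : ∀ y, 0 ≤ F y) (hF' : ∀ y, 0 ≤ deriv F y) (hχ : ContDiff ℝ 1 χ) (hχ0 : ∀ x, 0 ≤ χ x)
    (hχ1 : ∀ x, χ x ≤ 1) {B L : ℝ} (hχs : tsupport χ ⊆ Metric.closedBall 0 B)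
    (hχL : ∀ x, ‖gradient χ x‖ ≤ L) {a m : ℝ} (hm : 0 < m)
    (hvol : ENNReal.ofReal (m ^ n) ≤ volume {x | a < χ x * F (U x)}) :
    ENNReal.ofReal a * ENNReal.ofReal (n * m ^ (n - 1) * c) ≤
      (∫⁻ x in Metric.closedBall 0 B,
        ENNReal.ofReal (deriv F (U x)) * ENNReal.ofReal (suppFnR E (gradient U x))) +
      ∫⁻ x in Metric.closedBall 0 B, ENNReal.ofReal (D * L * F (U x)) := by
  have hD0 : 0 ≤ D := by simpa using hD h0
  have hne : E.Nonempty := ⟨0, h0⟩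
  have hχs' : HasCompactSupport χ :=
    (isCompact_closedBall 0 B).of_isClosed_subset (isClosed_tsupport χ) hχs
  have hw : ContDiff ℝ 1 fun x => χ x * F (U x) := hχ.mul (hF.comp hU)
  have hws : HasCompactSupport fun x => χ x * F (U x) := hχs'.mul_right
  have iso := isoperimetric_of_contDiff hn h0 hEm hD hc hEc
    (fun ξ η hη => inner_le_suppFnR hD ξ hη) hw hws
    (fun x => mul_nonneg (hχ0 x) (hF0 _)) hm hvol
  refine iso.trans ?_
  have hgrad : ∀ x, gradient (fun x => χ x * F (U x)) x =
      (χ x * deriv F (U x)) • gradient U x + F (U x) • gradient χ x := by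
    intro x
    have hUd := ((hU.differentiable (by simp)) x).hasFDerivAt
    have hχd := ((hχ.differentiable (by simp)) x).hasFDerivAt
    have hFd := ((hF.differentiable (by simp)) (U x)).hasDerivAt
    have := hχd.mul (hFd.comp_hasFDerivAt x hUd)
    rw [gradient, gradient, gradient, HasFDerivAt.fderiv (f := fun x => χ x * F (U x)) this]
    simp [mul_smul]
  have hpt : ∀ x, ENNReal.ofReal (suppFnR E (gradient (fun x => χ x * F (U x)) x)) ≤
      (Metric.closedBall 0 B).indicator (fun x =>
        ENNReal.ofReal (deriv F (U x)) * ENNReal.ofReal (suppFnR E (gradient U x)) +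
        ENNReal.ofReal (D * L * F (U x))) x := by
    intro x
    by_cases hx : x ∈ Metric.closedBall (0 : Euc n) B
    · rw [indicator_of_mem hx, ← ENNReal.ofReal_mul (hF' _), ← ENNReal.ofReal_add
        (mul_nonneg (hF' _) (suppFnR_nonneg hD h0 _))
        (mul_nonneg (mul_nonneg hD0 ((norm_nonneg _).trans (hχL 0))) (hF0 _))]
      refine ENNReal.ofReal_le_ofReal ?_
      rw [hgrad]
      refine (suppFnR_add_le hD hne _ _).trans (add_le_add ?_ ?_)
      · refine (suppFnR_smul_le hD hne (mul_nonneg (hχ0 x) (hF' _)) _).trans ?_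
        refine mul_le_mul_of_nonneg_right ?_ (suppFnR_nonneg hD h0 _)
        exact mul_le_of_le_one_left (hF' _) (hχ1 x)
      · refine (suppFnR_le_mul_norm hD hne _).trans ?_
        rw [norm_smul, Real.norm_of_nonneg (hF0 _), mul_assoc, mul_comm L]
        gcongr
        · exact hF0 _
        · exact hχL x
    · have : gradient (fun x => χ x * F (U x)) x = 0 := by
        rw [gradient, fderiv_of_notMem_tsupport, map_zero]
        exact fun h => hx (hχs (tsupport_mul_subset_left h))
      rw [this, indicator_of_notMem hx]
      simpa using suppFnR_le hne (ξ := 0) (a := 0) (by simp)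
  refine (lintegral_mono hpt).trans ?_
  rw [lintegral_indicator Metric.isClosed_closedBall.measurableSet, lintegral_add_right]
  exact ((hF.continuous.comp hU.continuous).measurable.const_mul (D * L)).ennreal_ofReal

theorem HasWeakGradient.isoperimetric_truncation {u : Euc n → ℝ} {g : Euc n → Euc n}
    (hu : HasWeakGradient u g) (hn : 1 ≤ n) (h0 : (0 : Euc n) ∈ E) (hEm : MeasurableSet E)
    (hD : E ⊆ Metric.closedBall 0 D) (hc : 0 < c) (hEc : volume E = ENNReal.ofReal (c ^ n))
    {F : ℝ → ℝ} (hF : ContDiff ℝ 1 F) {I : ℝ}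
    (hF0 : ∀ y, 0 ≤ F y) (hFI : ∀ y, F y ≤ I) (hF' : ∀ y, 0 ≤ deriv F y)
    (hF1 : ∀ y, deriv F y ≤ 1) {χ : Euc n → ℝ} (hχ : ContDiff ℝ 1 χ) (hχ0 : ∀ x, 0 ≤ χ x)
    (hχ1 : ∀ x, χ x ≤ 1) {R B L : ℝ} (hB : 0 ≤ B) (hχR : ∀ x ∈ Metric.closedBall 0 R, χ x = 1)
    (hχs : tsupport χ ⊆ Metric.closedBall 0 B)
    (hχL : ∀ x, ‖gradient χ x‖ ≤ L) {a m : ℝ} (hm : 0 < m)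
    (hvol : ENNReal.ofReal (m ^ n) < volume ({x | a < F (u x)} ∩ Metric.closedBall 0 R)) :
    ENNReal.ofReal a * ENNReal.ofReal (n * m ^ (n - 1) * c) ≤
      (∫⁻ x in Metric.closedBall 0 B,
        ENNReal.ofReal (deriv F (u x)) * ENNReal.ofReal (suppFnR E (g x))) +
      ∫⁻ x in Metric.closedBall 0 B, ENNReal.ofReal (D * L * F (u x)) := by
  have hD0 : 0 ≤ D := by simpa using hD h0
  have hL0 : 0 ≤ L := (norm_nonneg _).trans (hχL 0)
  have hne : E.Nonempty := ⟨0, h0⟩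
  have hcont := continuous_suppFnR hD hne
  have hFd : Continuous (deriv F) := hF.continuous_deriv le_rfl
  have hkm : AEStronglyMeasurable (fun x => suppFnR E (g x)) volume :=
    hcont.comp_aestronglyMeasurable hu.2.1.aestronglyMeasurable
  have hkfin : ∀ R, (∫⁻ x in Metric.closedBall 0 R, ENNReal.ofReal (suppFnR E (g x))) ≠ ⊤ := by
    intro R
    have i1 : Integrable g (volume.restrict (Metric.closedBall 0 R)) :=
      hu.2.1.integrableOn_isCompact (isCompact_closedBall 0 R)
    have i2 : Integrable (fun x => suppFnR E (g x)) (volume.restrict (Metric.closedBall 0 R)) := by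
      refine (i1.norm.const_mul D).mono' hkm.restrict (Eventually.of_forall fun x => ?_)
      rw [Real.norm_of_nonneg (suppFnR_nonneg hD h0 _)]
      exact suppFnR_le_mul_norm hD hne _
    exact i2.lintegral_lt_top.ne
  obtain ⟨U, hU, hUu, hUg, hUk⟩ := hu.exists_approx hD h0
  set μ := volume.restrict (Metric.closedBall (0 : Euc n) B)
  have hbump : ∀ᶠ j in atTop, ENNReal.ofReal (m ^ n) ≤ volume {x | a < χ x * F (U j x)} := by
    refine exists_le_measure_of_ae_eventually ?_ hvol
    filter_upwards [hUu] with x hx hxT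
    have h1 : Tendsto (fun j => χ x * F (U j x)) atTop (𝓝 (F (u x))) := by
      rw [hχR x hxT.2]
      simp only [one_mul]
      exact (hF.continuous.tendsto _).comp hx
    exact h1.eventually (lt_mem_nhds hxT.1)
  have hum : AEMeasurable u μ := hu.1.aestronglyMeasurable.aemeasurable.restrict
  have hkt : Tendsto (fun j : ℕ => ∫⁻ x in Metric.closedBall 0 (B + 2 * (1 / ((j : ℝ) + 1))),
      ENNReal.ofReal (suppFnR E (g x))) atTop
      (𝓝 (∫⁻ x in Metric.closedBall 0 B, ENNReal.ofReal (suppFnR E (g x)))) := by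
    refine tendsto_setLIntegral_closedBall hkfin hB (fun j => by positivity) ?_
    have := (tendsto_one_div_add_atTop_nhds_zero_nat (𝕜 := ℝ)).const_mul 2
    rwa [mul_zero] at this
  have hsecond : Tendsto (fun j => ∫⁻ x, ENNReal.ofReal (D * L * F (U j x)) ∂μ) atTop
      (𝓝 (∫⁻ x, ENNReal.ofReal (D * L * F (u x)) ∂μ)) := by
    refine tendsto_lintegral_of_dominated_convergence (fun _ => ENNReal.ofReal (D * L * I))
      (fun j => ((hF.continuous.comp (hU j).continuous).measurable.const_mul
        (D * L)).ennreal_ofReal) (fun j => Eventually.of_forall fun x => ?_) ?_ ?_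
    · exact ENNReal.ofReal_le_ofReal (mul_le_mul_of_nonneg_left (hFI _) (mul_nonneg hD0 hL0))
    · rw [lintegral_const]
      exact ENNReal.mul_ne_top ENNReal.ofReal_ne_top (by
        rw [Measure.restrict_apply_univ]
        exact measure_closedBall_lt_top.ne)
    · filter_upwards [ae_restrict_of_ae hUu] with x hx
      exact ENNReal.tendsto_ofReal (((hF.continuous.tendsto _).comp hx).const_mul _)
  refine ENNReal.le_of_forall_pos_le_add fun δ hδ _ => ?_
  have hδ2 : (δ : ℝ≥0∞) / 2 ≠ 0 := (ENNReal.half_pos (by simpa using hδ.ne')).ne'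
  have hfirst := eventually_lintegral_mul_le (μ := μ)
    (a := fun j x => ENNReal.ofReal (deriv F (U j x)))
    (k := fun j x => ENNReal.ofReal (suppFnR E (gradient (U j) x)))
    (a' := fun x => ENNReal.ofReal (deriv F (u x)))
    (k' := fun x => ENNReal.ofReal (suppFnR E (g x)))
    (fun j => (hFd.comp (hU j).continuous).measurable.ennreal_ofReal.aemeasurable)
    (hFd.measurable.comp_aemeasurable hum).ennreal_ofReal
    (fun j => by
      have : Continuous (gradient (U j)) :=
        (InnerProductSpace.toDual ℝ (Euc n)).symm.continuous.comp
          ((hU j).continuous_fderiv (by simp))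
      exact (hcont.comp this).measurable.ennreal_ofReal.aemeasurable)
    (fun j x => by simpa using hF1 _) (fun x => by simpa using hF1 _)
    (fun x => ENNReal.ofReal_ne_top)
    (by
      filter_upwards [ae_restrict_of_ae hUu] with x hx
      exact ENNReal.tendsto_ofReal ((hFd.tendsto _).comp hx))
    (by
      filter_upwards [ae_restrict_of_ae hUg] with x hx
      exact ENNReal.tendsto_ofReal ((hcont.tendsto _).comp hx))
    (hkfin B)
    (fun δ hδ => by
      filter_upwards [hkt.eventually_le_const (ENNReal.lt_add_right (hkfin B) hδ)] with j hj
      exact (hUk j B).trans hj) hδ2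
  have hsec : ∀ᶠ j in atTop, (∫⁻ x, ENNReal.ofReal (D * L * F (U j x)) ∂μ) ≤
      (∫⁻ x, ENNReal.ofReal (D * L * F (u x)) ∂μ) + δ / 2 := by
    refine hsecond.eventually_le_const (ENNReal.lt_add_right ?_ hδ2)
    refine ne_top_of_le_ne_top (b := ∫⁻ x, ENNReal.ofReal (D * L * I) ∂μ) ?_
      (lintegral_mono fun x =>
      ENNReal.ofReal_le_ofReal (mul_le_mul_of_nonneg_left (hFI _) (mul_nonneg hD0 hL0)))
    rw [lintegral_const]
    exact ENNReal.mul_ne_top ENNReal.ofReal_ne_top (by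
      rw [Measure.restrict_apply_univ]
      exact measure_closedBall_lt_top.ne)
  obtain ⟨j, h1, h2, h3⟩ := (hbump.and (hfirst.and hsec)).exists
  refine (_root_.isoperimetric_truncation hn h0 hEm hD hc hEc (hU j) hF hF0 hF' hχ hχ0 hχ1
    hχs hχL hm h1).trans ((add_le_add h2 h3).trans ?_)
  rw [add_add_add_comm, ENNReal.add_halves]

/-- Isoperimetric estimate for a weakly differentiable function between two levels. -/
theorem HasWeakGradient.isoperimetric_strip {u : Euc n → ℝ} {g : Euc n → Euc n}
    (hu : HasWeakGradient u g) (hum : Measurable u) (hn : 1 ≤ n) (h0 : (0 : Euc n) ∈ E)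
    (hEm : MeasurableSet E)
    (hD : E ⊆ Metric.closedBall 0 D) (hc : 0 < c) (hEc : volume E = ENNReal.ofReal (c ^ n))
    {s t m : ℝ} (hst : s < t) (hm : 0 < m) (hfin : volume {x | s < u x} ≠ ⊤)
    (hvol : ENNReal.ofReal (m ^ n) ≤ volume {x | t < u x}) :
    ENNReal.ofReal ((t - s) * (n * m ^ (n - 1) * c)) ≤
      ∫⁻ x in {x | s < u x ∧ u x < t}, ENNReal.ofReal (suppFnR E (g x)) := by
  have hn0 : n ≠ 0 := by omega
  have hD0 : 0 ≤ D := by simpa using hD h0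
  obtain ⟨C, hC, hcut⟩ := exists_contDiff_cutoff n
  have hstripm : MeasurableSet {x | s < u x ∧ u x < t} :=
    (measurableSet_lt measurable_const hum).inter (measurableSet_lt hum measurable_const)
  have hsm : MeasurableSet {x | s < u x} := measurableSet_lt measurable_const hum
  have key : ∀ l : ℝ, 0 < l → l < 1 →
      ENNReal.ofReal (l * (t - s) * (n * (l * m) ^ (n - 1) * c)) ≤
      ∫⁻ x in {x | s < u x ∧ u x < t}, ENNReal.ofReal (suppFnR E (g x)) := by
    intro l hl hl1
    obtain ⟨F, I, hlI, -, hF, hF', hF1, hFs, hFz, hFt, hF0, hFI⟩ :=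
      exists_contDiff_truncation hst (l := l * (t - s)) (by nlinarith)
    have hI0 : 0 ≤ I := (hF0 0).trans (hFI 0)
    have hev : ∀ᶠ R : ℕ in atTop, ENNReal.ofReal ((l * m) ^ n) <
        volume ({x | l * (t - s) < F (u x)} ∩ Metric.closedBall 0 R) := by
      have hlt : ENNReal.ofReal ((l * m) ^ n) < volume {x | l * (t - s) < F (u x)} := by
        refine lt_of_lt_of_le ?_ (hvol.trans (measure_mono fun x (hx : t < u x) => ?_))
        · rw [ENNReal.ofReal_lt_ofReal_iff (by positivity)]
          exact pow_lt_pow_left₀ (by nlinarith) (by positivity) hn0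
        · simpa [hFt _ hx.le] using hlI
      have hmono : Monotone fun R : ℕ =>
          {x | l * (t - s) < F (u x)} ∩ Metric.closedBall (0 : Euc n) R := fun R R' h =>
        inter_subset_inter_right _ (Metric.closedBall_subset_closedBall (by exact_mod_cast h))
      have ht := tendsto_measure_iUnion_atTop (μ := volume) hmono
      rw [← inter_iUnion, Metric.iUnion_closedBall_nat, inter_univ] at ht
      exact ht.eventually (lt_mem_nhds hlt)
    have hest : ∀ᶠ R : ℕ in atTop,
        ENNReal.ofReal (l * (t - s) * (n * (l * m) ^ (n - 1) * c)) ≤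
        (∫⁻ x in {x | s < u x ∧ u x < t}, ENNReal.ofReal (suppFnR E (g x))) +
          ENNReal.ofReal (D * (C / R) * I) * volume {x | s < u x} := by
      filter_upwards [hev, eventually_gt_atTop 0] with R hR hR0
      have hR0' : (0 : ℝ) < R := by exact_mod_cast hR0
      obtain ⟨χ, hχ, hχ0, hχ1, hχR, hχs, hχL⟩ := hcut R hR0'
      have h1 := hu.isoperimetric_truncation hn h0 hEm hD hc hEc hF hF0 hFI hF' hF1 hχ hχ0 hχ1
        (by positivity) hχR hχs hχL (mul_pos hl hm) hR
      rw [← ENNReal.ofReal_mul (mul_nonneg hl.le (by linarith))] at h1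
      refine h1.trans (add_le_add ?_ ?_)
      · refine (setLIntegral_le_lintegral _ _).trans ?_
        rw [← lintegral_indicator hstripm]
        refine lintegral_mono fun x => ?_
        by_cases hx : u x ∈ Ioo s t
        · rw [indicator_of_mem (show x ∈ {x | s < u x ∧ u x < t} from hx)]
          exact mul_le_of_le_one_left zero_le (by simpa using hF1 _)
        · simp [hFs _ hx]
      · refine (setLIntegral_le_lintegral _ _).trans ?_
        rw [← lintegral_indicator_const hsm]
        refine lintegral_mono fun x => ?_
        by_cases hx : s < u x
        · rw [indicator_of_mem (show x ∈ {x | s < u x} from hx)]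
          refine ENNReal.ofReal_le_ofReal (mul_le_mul_of_nonneg_left (hFI _) (by positivity))
        · simp [hFz _ (not_lt.1 hx)]
    refine ge_of_tendsto (x := atTop) ?_ hest
    have h2 : Tendsto (fun R : ℕ => D * (C / R) * I) atTop (𝓝 0) := by
      have := ((tendsto_const_div_atTop_nhds_zero_nat C).const_mul D).mul_const I
      simpa using this
    have h3 := ENNReal.Tendsto.mul_const (ENNReal.tendsto_ofReal h2) (Or.inr hfin)
    simpa using h3.const_add (∫⁻ x in {x | s < u x ∧ u x < t}, ENNReal.ofReal (suppFnR E (g x)))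
  have hcont : Continuous fun l : ℝ =>
      ENNReal.ofReal (l * (t - s) * (n * (l * m) ^ (n - 1) * c)) :=
    ENNReal.continuous_ofReal.comp (by fun_prop)
  have hlim : Tendsto (fun l : ℝ => ENNReal.ofReal (l * (t - s) * (n * (l * m) ^ (n - 1) * c)))
      (𝓝[<] 1) (𝓝 (ENNReal.ofReal ((t - s) * (n * m ^ (n - 1) * c)))) := by
    have := (hcont.tendsto 1).mono_left (nhdsWithin_le_nhds (s := Iio 1))
    simpa using this
  refine le_of_tendsto hlim ?_
  filter_upwards [Ioo_mem_nhdsLT (zero_lt_one' ℝ)] with l hl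
  exact key l hl.1 hl.2

end Strip

section YoungConjugate

variable {n : ℕ} {Φ : Euc n → ℝ≥0∞}

theorem yconj_le_iff {ξ : Euc n} {t : ℝ≥0∞} :
    yconj Φ ξ ≤ t ↔ ∀ η, ENNReal.ofReal ⟪ξ, η⟫ ≤ t + Φ η := by
  simp [yconj, tsub_le_iff_right]

theorem yconj_zero : yconj Φ 0 = 0 := by
  rw [← nonpos_iff_eq_zero, yconj_le_iff]
  simp

theorem isClosed_yconj_le (t : ℝ≥0∞) : IsClosed {ξ | yconj Φ ξ ≤ t} := by
  simp_rw [yconj_le_iff, ofPred_forall]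
  exact isClosed_iInter fun η => isClosed_le
    (ENNReal.continuous_ofReal.comp (by fun_prop)) continuous_const

theorem IsNYoung.exists_yconj_le_subset_closedBall (hΦ : IsNYoung Φ) (τ : ℝ) :
    ∃ D, {ξ | yconj Φ ξ ≤ ENNReal.ofReal τ} ⊆ Metric.closedBall 0 D := by
  obtain ⟨ε, hε, hfin⟩ := hΦ.finite_near_zero
  let e : Fin n → Euc n := fun i => EuclideanSpace.single i (1 : ℝ)
  have hne : ∀ (i : Fin n) (r : ℝ), |r| < ε → Φ (r • e i) ≠ ⊤ := by
    intro i r hr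
    refine hfin _ ?_
    simpa [e, norm_smul] using hr
  let M : Fin n → ℝ := fun i => (ENNReal.ofReal τ + (Φ ((ε / 2) • e i) +
    Φ ((-(ε / 2)) • e i))).toReal
  have hcoord : ∀ ξ : Euc n, yconj Φ ξ ≤ ENNReal.ofReal τ → ∀ i, |ξ i| ≤ 2 / ε * M i := by
    intro ξ hξ i
    have h1 : Φ ((ε / 2) • e i) ≠ ⊤ := hne i _ (by rw [abs_of_pos (by positivity)]; linarith)
    have h2 : Φ ((-(ε / 2)) • e i) ≠ ⊤ :=
      hne i _ (by rw [abs_neg, abs_of_pos (by positivity)]; linarith)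
    have hb : ∀ r : ℝ, Φ (r • e i) ≤ Φ ((ε / 2) • e i) + Φ ((-(ε / 2)) • e i) →
        r * ξ i ≤ M i := by
      intro r hr
      have h := (yconj_le_iff.1 hξ (r • e i)).trans (add_le_add_right hr _)
      have h3 : ⟪ξ, r • e i⟫ = r * ξ i := by
        simp [e, real_inner_smul_right, EuclideanSpace.inner_single_right]
      rw [h3, ENNReal.ofReal_le_iff_le_toReal
          (ENNReal.add_ne_top.2 ⟨ENNReal.ofReal_ne_top, ENNReal.add_ne_top.2 ⟨h1, h2⟩⟩)] at h
      exact h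
    have h3 := hb (ε / 2) le_self_add
    have h4 := hb (-(ε / 2)) le_add_self
    have h5 : (ε / 2) * |ξ i| ≤ M i := by
      rcases abs_cases (ξ i) with h | h <;> rw [h.1] <;> linarith
    calc |ξ i| = 2 / ε * ((ε / 2) * |ξ i|) := by field_simp
      _ ≤ 2 / ε * M i := by gcongr
  refine ⟨∑ i, 2 / ε * M i, fun ξ hξ => ?_⟩
  rw [mem_closedBall_zero_iff]
  calc ‖ξ‖ ≤ ∑ i, ‖ξ i‖ := by
        rw [EuclideanSpace.norm_eq]
        refine Real.sqrt_le_iff.2 ⟨Finset.sum_nonneg fun i _ => norm_nonneg _, ?_⟩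
        exact Finset.sum_sq_le_sq_sum_of_nonneg fun i _ => norm_nonneg _
    _ ≤ ∑ i, 2 / ε * M i := Finset.sum_le_sum fun i _ => hcoord ξ hξ i

theorem IsNYoung.exists_ball_subset_yconj_le (hΦ : IsNYoung Φ) {τ : ℝ} (hτ : 0 < τ) :
    ∃ r > 0, Metric.ball 0 r ⊆ {ξ | yconj Φ ξ ≤ ENNReal.ofReal τ} := by
  have h1 : ∀ᶠ x in Bornology.cobounded (Euc n), 1 ≤ Φ x :=
    hΦ.coercive.eventually (eventually_ge_nhds ENNReal.one_lt_top)
  obtain ⟨R, -, hR⟩ := (Filter.hasBasis_cobounded_norm (E := Euc n)).eventually_iff.1 h1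
  set R' := max R 1
  have hR'0 : 0 < R' := lt_max_of_lt_right one_pos
  have hgrow : ∀ η : Euc n, R' ≤ ‖η‖ → ENNReal.ofReal (‖η‖ / R') ≤ Φ η := by
    intro η hη
    have hη0 : 0 < ‖η‖ := hR'0.trans_le hη
    have h2 : 1 ≤ Φ ((R' / ‖η‖) • η) := by
      refine hR ?_
      simp only [mem_ofPred_eq, norm_smul, norm_div, norm_norm, Real.norm_of_nonneg hR'0.le]
      rw [div_mul_cancel₀ _ hη0.ne']
      exact le_max_left _ _
    have h3 := hΦ.convex η 0 (R' / ‖η‖) (1 - R' / ‖η‖) (by positivity)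
      (by rw [sub_nonneg, div_le_one hη0]; exact hη) (by ring)
    rw [smul_zero, add_zero, hΦ.map_zero, mul_zero, add_zero] at h3
    calc ENNReal.ofReal (‖η‖ / R') ≤ ENNReal.ofReal (‖η‖ / R') *
          (ENNReal.ofReal (R' / ‖η‖) * Φ η) := le_mul_of_one_le_right zero_le (h2.trans h3)
      _ = Φ η := by
        rw [← mul_assoc, ← ENNReal.ofReal_mul (by positivity)]
        rw [show ‖η‖ / R' * (R' / ‖η‖) = 1 by field_simp]
        simp
  refine ⟨min (1 / R') (τ / R'), by positivity, fun ξ hξ => ?_⟩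
  rw [mem_ball_zero_iff, lt_min_iff] at hξ
  refine yconj_le_iff.2 fun η => ?_
  have h4 : ⟪ξ, η⟫ ≤ ‖ξ‖ * ‖η‖ := real_inner_le_norm _ _
  rcases le_total R' ‖η‖ with h | h
  · refine le_trans (ENNReal.ofReal_le_ofReal ?_) ((hgrow η h).trans le_add_self)
    refine h4.trans ?_
    rw [div_eq_mul_one_div, mul_comm]
    gcongr
    exact hξ.1.le
  · refine le_trans (ENNReal.ofReal_le_ofReal ?_) le_self_add
    refine h4.trans ?_
    calc ‖ξ‖ * ‖η‖ ≤ τ / R' * R' := by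
          gcongr
          exact hξ.2.le
      _ = τ := by field_simp

theorem ofReal_suppFnR_yconj_le (τ : ℝ) (ξ : Euc n) :
    ENNReal.ofReal (suppFnR {η | yconj Φ η ≤ ENNReal.ofReal τ} ξ) ≤ Φ ξ + ENNReal.ofReal τ := by
  rcases eq_or_ne (Φ ξ) ⊤ with h | h
  · simp [h]
  rw [ENNReal.ofReal_le_iff_le_toReal (by simp [h])]
  refine suppFnR_le ⟨0, by simp [yconj_zero]⟩ fun η hη => ?_
  have := yconj_le_iff.1 hη ξ
  rw [ENNReal.ofReal_le_iff_le_toReal (by simp [h]), real_inner_comm, add_comm] at this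
  exact this

theorem IsNYoung.exists_volume_yconj_le_eq (hΦ : IsNYoung Φ) (hn : 1 ≤ n) {τ : ℝ} (hτ : 0 < τ)
    {V : ℝ} (hV : 0 < V) : ∃ κ > 0,
      volume {ξ | yconj Φ ξ ≤ ENNReal.ofReal τ} = ENNReal.ofReal (V * κ ^ n) := by
  obtain ⟨D, hD⟩ := hΦ.exists_yconj_le_subset_closedBall τ
  obtain ⟨r, hr, hr'⟩ := hΦ.exists_ball_subset_yconj_le hτ
  set v := volume {ξ | yconj Φ ξ ≤ ENNReal.ofReal τ}
  have hv : v ≠ ⊤ := ((measure_mono hD).trans_lt measure_closedBall_lt_top).ne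
  have hv0 : 0 < v := (Metric.measure_ball_pos volume _ hr).trans_le (measure_mono hr')
  have h1 : 0 < v.toReal := ENNReal.toReal_pos hv0.ne' hv
  refine ⟨(v.toReal / V) ^ ((n : ℝ)⁻¹), by positivity, ?_⟩
  rw [Real.rpow_inv_natCast_pow (by positivity) (by omega), mul_div_cancel₀ _ hV.ne',
    ENNReal.ofReal_toReal hv]

theorem gauge_le_of_youngSymm_lt {K : Set (Euc n)} (hn : 1 ≤ n) (hK : volume K ≠ ⊤)
    (hK0 : volume K ≠ 0) {Ψ : Euc n → ℝ≥0∞} {τ κ : ℝ} (hκ : 0 ≤ κ)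
    (hv : volume {ξ | Ψ ξ ≤ ENNReal.ofReal τ} = ENNReal.ofReal ((volume K).toReal * κ ^ n))
    {η : Euc n} (h : youngSymm K Ψ η < ENNReal.ofReal τ) : gauge K (-η) ≤ κ := by
  obtain ⟨t, ht, htτ⟩ := sInf_lt_iff.1 h
  have h1 : volume K * ENNReal.ofReal (gauge K (-η) ^ n) ≤ volume K * ENNReal.ofReal (κ ^ n) := by
    refine le_trans (show _ ≤ _ from ht) ?_
    refine (measure_mono (t := {ξ | Ψ ξ ≤ ENNReal.ofReal τ})
      fun ξ (hξ : Ψ ξ ≤ t) => hξ.trans htτ.le).trans ?_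
    rw [hv, ENNReal.ofReal_mul ENNReal.toReal_nonneg, ENNReal.ofReal_toReal hK]
  rw [ENNReal.mul_le_mul_iff_right hK0 hK, ENNReal.ofReal_le_ofReal_iff (by positivity)] at h1
  exact le_of_pow_le_pow_left₀ (by omega) hκ h1

end YoungConjugate

/-- Energy estimate between two levels for a function of finite `Φ`-energy. -/
theorem HasWeakGradient.strip_le {n : ℕ} {Φ : Euc n → ℝ≥0∞} (hΦ : IsNYoung Φ)
    {u : Euc n → ℝ} {g : Euc n → Euc n} (hu : HasWeakGradient u g) (hum : Measurable u)
    (hn : 1 ≤ n) {τ V κ : ℝ} (hV : 0 < V) (hκ : 0 < κ)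
    (hv : volume {ξ | yconj Φ ξ ≤ ENNReal.ofReal τ} = ENNReal.ofReal (V * κ ^ n))
    {s t a : ℝ} (hst : s < t) (ha : 0 < a) (hfin : volume {x | s < u x} ≠ ⊤)
    (hvol : ENNReal.ofReal (V * a ^ n) ≤ volume {x | t < u x}) :
    ENNReal.ofReal ((t - s) * (n * V * a ^ (n - 1) * κ)) ≤
      (∫⁻ x in {x | s < u x ∧ u x < t}, Φ (g x)) +
        ENNReal.ofReal τ * volume {x | s < u x ∧ u x < t} := by
  have hn0 : n ≠ 0 := by omega
  obtain ⟨D, hD⟩ := hΦ.exists_yconj_le_subset_closedBall τ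
  set k := V ^ ((n : ℝ)⁻¹)
  have hk : 0 < k := by positivity
  have hkn : k ^ n = V := Real.rpow_inv_natCast_pow hV.le hn0
  have h := hu.isoperimetric_strip hum hn (E := {ξ | yconj Φ ξ ≤ ENNReal.ofReal τ})
    (by simp [yconj_zero]) (isClosed_yconj_le _).measurableSet hD (c := k * κ) (by positivity)
    (by rw [hv, mul_pow, hkn]) hst (m := k * a) (by positivity) hfin
    (by rwa [mul_pow, hkn])
  have e : (n : ℝ) * (k * a) ^ (n - 1) * (k * κ) = n * V * a ^ (n - 1) * κ := by
    rw [mul_pow, ← hkn]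
    obtain ⟨p, rfl⟩ := Nat.exists_eq_succ_of_ne_zero hn0
    simp only [Nat.succ_eq_add_one, add_tsub_cancel_right, pow_succ]
    ring
  rw [e] at h
  refine h.trans ((lintegral_mono fun x => ofReal_suppFnR_yconj_le τ (g x)).trans ?_)
  rw [lintegral_add_right _ measurable_const, lintegral_const, Measure.restrict_apply_univ]

section Rearrangement

variable {n : ℕ} {u : Euc n → ℝ}

theorem distFn_antitone (u : Euc n → ℝ) : Antitone (distFn u) :=
  fun _ _ hst => measure_mono fun _ hx => hst.trans_lt hx

theorem eInf_lt_top (u : Euc n → ℝ) : eInf u < ⊤ := by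
  obtain ⟨x, hx⟩ := (ae_essInf_le (f := fun x => (u x : EReal)) (μ := volume)).exists
  exact hx.trans_lt (EReal.coe_lt_top _)

theorem MemMd.exists_distFn_le (hu : MemMd u) {s : ℝ} (hs : 0 < s) :
    ∃ t, distFn u t ≤ ENNReal.ofReal s := by
  obtain ⟨t₀, ht₀, -⟩ := EReal.lt_iff_exists_real_btwn.1 (eInf_lt_top u)
  have h := tendsto_measure_iInter_atTop (μ := volume) (s := fun t : ℝ => {x | t < u x})
    (fun t => (measurableSet_lt measurable_const hu.1).nullMeasurableSet)
    (fun _ _ hst _ hx => lt_of_le_of_lt hst hx) ⟨t₀, (hu.2 t₀ ht₀).ne⟩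
  have h0 : ⋂ t : ℝ, {x | t < u x} = ∅ :=
    eq_empty_of_forall_notMem fun x hx => lt_irrefl (u x) (mem_iInter.1 hx (u x))
  rw [h0, measure_empty] at h
  exact ((tendsto_order.1 h).2 _ (ENNReal.ofReal_pos.2 hs)).exists.imp fun _ h => h.le

theorem exists_lt_distFn (hn : 1 ≤ n) (u : Euc n → ℝ) (s : ℝ) :
    ∃ t, ENNReal.ofReal s < distFn u t := by
  have : Nonempty (Fin n) := ⟨⟨0, hn⟩⟩
  have h := tendsto_measure_iUnion_atBot (μ := volume) (s := fun t : ℝ => {x | t < u x})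
    (fun _ _ hst _ hx => lt_of_le_of_lt hst hx)
  have h0 : ⋃ t : ℝ, {x | t < u x} = univ :=
    eq_univ_of_forall fun x => mem_iUnion.2 ⟨u x - 1, sub_one_lt (u x)⟩
  rw [h0, measure_univ_of_isAddLeftInvariant] at h
  exact ((tendsto_order.1 h).1 _ ENNReal.ofReal_lt_top).exists

theorem distFn_le_of_forall_lt {t : ℝ} {c : ℝ≥0∞} (h : ∀ t' > t, distFn u t' ≤ c) :
    distFn u t ≤ c := by
  obtain ⟨w, hw, hwt, hw'⟩ := exists_seq_strictAnti_tendsto t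
  have e : {x | t < u x} = ⋃ k, {x | w k < u x} := by
    ext x
    simp only [mem_ofPred_eq, mem_iUnion]
    exact ⟨fun hx => ((tendsto_order.1 hw').2 _ hx).exists, fun ⟨k, hk⟩ => (hwt k).trans hk⟩
  have hm : Monotone fun k => {x | w k < u x} :=
    fun i j hij x hx => (hw.antitone hij).trans_lt hx
  rw [distFn, e, hm.measure_iUnion]
  exact iSup_le fun k => h _ (hwt k)

theorem MemMd.decRearr_le_iff (hu : MemMd u) (hn : 1 ≤ n) {s : ℝ} (hs : 0 < s) {t : ℝ} :
    decRearr u s ≤ t ↔ distFn u t ≤ ENNReal.ofReal s := by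
  refine ⟨fun h => distFn_le_of_forall_lt fun t' ht' => ?_, fun h => csInf_le ?_ h⟩
  · obtain ⟨t₁, h₁, h₂⟩ := exists_lt_of_csInf_lt (hu.exists_distFn_le hs) (h.trans_lt ht')
    exact (distFn_antitone u h₂.le).trans h₁
  · obtain ⟨t₀, h₀⟩ := exists_lt_distFn hn u s
    exact ⟨t₀, fun t' ht' => le_of_not_gt fun hlt =>
      (h₀.trans_le (distFn_antitone u hlt.le)).not_ge ht'⟩

theorem MemMd.lt_decRearr_iff (hu : MemMd u) (hn : 1 ≤ n) {s : ℝ} (hs : 0 < s) {t : ℝ} :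
    t < decRearr u s ↔ ENNReal.ofReal s < distFn u t := by
  rw [← not_le, hu.decRearr_le_iff hn hs, not_le]

theorem MemMd.decRearr_anti (hu : MemMd u) (hn : 1 ≤ n) {s t : ℝ} (hs : 0 < s) (hst : s ≤ t) :
    decRearr u t ≤ decRearr u s := by
  rw [hu.decRearr_le_iff hn (hs.trans_le hst)]
  exact ((hu.decRearr_le_iff hn hs).1 le_rfl).trans (ENNReal.ofReal_le_ofReal hst)

/-- Between the levels `u*(t)` and `u*(s)` there is at most volume `t - s`. -/
theorem MemMd.volume_strip_le (hu : MemMd u) (hn : 1 ≤ n) {s t : ℝ} (hs : 0 < s) (hst : s ≤ t) :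
    volume {x | decRearr u t < u x ∧ u x < decRearr u s} ≤ ENNReal.ofReal (t - s) := by
  obtain ⟨w, hw, hwt, hw'⟩ := exists_seq_strictMono_tendsto (decRearr u s)
  have e : {x | decRearr u t < u x ∧ u x < decRearr u s} =
      ⋃ k, {x | decRearr u t < u x ∧ u x < w k} := by
    ext x
    simp only [mem_ofPred_eq, mem_iUnion, exists_and_left]
    exact and_congr_right fun _ =>
      ⟨fun hx => ((tendsto_order.1 hw').1 _ hx).exists, fun ⟨k, hk⟩ => hk.trans (hwt k)⟩
  have hm : Monotone fun k => {x | decRearr u t < u x ∧ u x < w k} :=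
    fun i j hij x hx => ⟨hx.1, hx.2.trans_le (hw.monotone hij)⟩
  rw [e, hm.measure_iUnion]
  refine iSup_le fun k => ?_
  by_cases hk : decRearr u t ≤ w k
  · have h1 := ((hu.lt_decRearr_iff hn hs).1 (hwt k)).le
    have h2 := (hu.decRearr_le_iff hn (hs.trans_le hst)).1 le_rfl
    rw [ENNReal.ofReal_sub _ hs.le]
    refine ENNReal.le_sub_of_add_le_right ENNReal.ofReal_ne_top ?_
    refine (add_le_add_right h1 _).trans (le_trans ?_ h2)
    rw [distFn, ← measure_union _ (measurableSet_lt measurable_const hu.1)]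
    · refine measure_mono (union_subset (fun x hx => hx.1) fun x hx => hk.trans_lt hx)
    · exact disjoint_left.2 fun x hx hx' => lt_asymm hx.2 hx'
  · rw [(eq_empty_of_forall_notMem fun x hx => hk (hx.1.trans hx.2).le : {x | _} = _)]
    simp

theorem HasWeakGradient.decRearr_strip_le {Φ : Euc n → ℝ≥0∞} (hΦ : IsNYoung Φ)
    {g : Euc n → Euc n} (hu : HasWeakGradient u g) (hud : MemMd u)
    (hn : 1 ≤ n) {τ V κ : ℝ} (hV : 0 < V) (hκ : 0 < κ)
    (hv : volume {ξ | yconj Φ ξ ≤ ENNReal.ofReal τ} = ENNReal.ofReal (V * κ ^ n))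
    {a b : ℝ} (ha : 0 < a) (hab : a ≤ b) :
    ENNReal.ofReal ((decRearr u (V * a ^ n) - decRearr u (V * b ^ n)) *
        (n * V * a ^ (n - 1) * κ)) ≤
      (∫⁻ x in {x | decRearr u (V * b ^ n) < u x ∧ u x < decRearr u (V * a ^ n)}, Φ (g x)) +
        ENNReal.ofReal τ * ENNReal.ofReal (V * b ^ n - V * a ^ n) := by
  have ha' : 0 < V * a ^ n := by positivity
  have hab' : V * a ^ n ≤ V * b ^ n := by gcongr
  rcases (hud.decRearr_anti hn ha' hab').eq_or_lt with h | h
  · simp [h]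
  have hvol := hud.volume_strip_le hn ha' hab'
  set α := decRearr u (V * a ^ n) with hα
  set β := decRearr u (V * b ^ n)
  have hc : Tendsto (fun t => ENNReal.ofReal ((t - β) * (n * V * a ^ (n - 1) * κ))) (𝓝[<] α)
      (𝓝 (ENNReal.ofReal ((α - β) * (n * V * a ^ (n - 1) * κ)))) := by
    refine (Continuous.tendsto (ENNReal.continuous_ofReal.comp (by fun_prop)) α).mono_left
      nhdsWithin_le_nhds
  refine le_of_tendsto hc ?_
  filter_upwards [Ioo_mem_nhdsLT h] with t ht
  have hb' : 0 < V * b ^ n := ha'.trans_le hab'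
  have hsub : {x | β < u x ∧ u x < t} ⊆ {x | β < u x ∧ u x < α} :=
    fun x hx => ⟨hx.1, hx.2.trans ht.2⟩
  refine (hu.strip_le hΦ hud.1 hn hV hκ hv ht.1 ha ?_ ?_).trans ?_
  · exact (((hud.decRearr_le_iff hn hb').1 le_rfl).trans_lt ENNReal.ofReal_lt_top).ne
  · exact ((hud.lt_decRearr_iff hn ha').1 ht.2).le
  · gcongr
    exact (measure_mono hsub).trans hvol

end Rearrangement

section RearrangementAC

variable {n : ℕ} {u : Euc n → ℝ}

theorem exists_pow_sub_pow_le (n : ℕ) (R : ℝ) :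
    ∃ L > 0, ∀ a b : ℝ, 0 ≤ a → a ≤ b → b ≤ R → b ^ n - a ^ n ≤ L * (b - a) := by
  refine ⟨n * |R| ^ (n - 1) + 1, by positivity, fun a b ha hab hb => ?_⟩
  have h := abs_pow_sub_pow_le b a n
  rw [abs_of_nonneg (sub_nonneg.2 hab), abs_of_nonneg (ha.trans hab), abs_of_nonneg ha,
    max_eq_left hab] at h
  refine (le_abs_self _).trans (h.trans ?_)
  have h1 : b ^ (n - 1) ≤ |R| ^ (n - 1) :=
    pow_le_pow_left₀ (ha.trans hab) (hb.trans (le_abs_self R)) _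
  nlinarith [mul_nonneg (n.cast_nonneg : (0 : ℝ) ≤ n) (sub_nonneg.2 h1), sub_nonneg.2 hab,
    mul_nonneg (mul_nonneg (n.cast_nonneg : (0 : ℝ) ≤ n) (sub_nonneg.2 h1)) (sub_nonneg.2 hab)]

/-- The radial profile of the rearrangement of a function of finite energy is locally absolutely
continuous. -/
theorem MemV1d.absolutelyContinuousOnInterval {Φ : Euc n → ℝ≥0∞} (hΦ : IsNYoung Φ)
    {g : Euc n → Euc n} (hu : MemV1d Φ u g) (hn : 1 ≤ n) {V : ℝ} (hV : 0 < V)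
    {a₀ b₀ : ℝ} (ha₀ : 0 < a₀) (hab₀ : a₀ ≤ b₀) :
    AbsolutelyContinuousOnInterval (fun r => decRearr u (V * r ^ n)) a₀ b₀ := by
  obtain ⟨huw, hud, hfin⟩ := hu
  obtain ⟨κ, hκ, hv⟩ := hΦ.exists_volume_yconj_le_eq hn one_pos hV
  obtain ⟨L, hL, hLb⟩ := exists_pow_sub_pow_le n b₀
  have hn' : (0 : ℝ) < n := by exact_mod_cast hn
  set f : ℝ → ℝ := fun r => decRearr u (V * r ^ n) with hf
  set c := n * V * a₀ ^ (n - 1) * κ with hc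
  have hc0 : 0 < c := by positivity
  have hanti : ∀ ⦃a b⦄, 0 < a → a ≤ b → f b ≤ f a := fun a b ha hab =>
    hud.decRearr_anti hn (by positivity) (by gcongr)
  set S : ℝ × ℝ → Set (Euc n) := fun p => {x | f (max p.1 p.2) < u x ∧ u x < f (min p.1 p.2)}
    with hS
  have hSm : ∀ p, MeasurableSet (S p) := fun p =>
    (measurableSet_lt measurable_const hud.1).inter (measurableSet_lt hud.1 measurable_const)
  have key : ∀ p : ℝ × ℝ, p.1 ∈ uIcc a₀ b₀ → p.2 ∈ uIcc a₀ b₀ →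
      ENNReal.ofReal (c * dist (f p.1) (f p.2)) ≤
        (∫⁻ x in S p, Φ (g x)) + ENNReal.ofReal (V * L * dist p.1 p.2) ∧
      volume (S p) ≤ ENNReal.ofReal (V * L * dist p.1 p.2) := by
    intro p h1 h2
    rw [uIcc_of_le hab₀] at h1 h2
    have ha : a₀ ≤ min p.1 p.2 := le_min h1.1 h2.1
    have hb : max p.1 p.2 ≤ b₀ := max_le h1.2 h2.2
    have hab : min p.1 p.2 ≤ max p.1 p.2 := min_le_max
    have hd : dist p.1 p.2 = max p.1 p.2 - min p.1 p.2 := by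
      rw [Real.dist_eq, max_sub_min_eq_abs']
    have hd' : dist (f p.1) (f p.2) = f (min p.1 p.2) - f (max p.1 p.2) := by
      rcases le_total p.1 p.2 with h | h
      · rw [min_eq_left h, max_eq_right h, Real.dist_eq,
          abs_of_nonneg (sub_nonneg.2 (hanti (ha₀.trans_le h1.1) h))]
      · rw [min_eq_right h, max_eq_left h, dist_comm, Real.dist_eq,
          abs_of_nonneg (sub_nonneg.2 (hanti (ha₀.trans_le h2.1) h))]
    rw [hd, hd']
    set a := min p.1 p.2
    set b := max p.1 p.2
    have ha0 : 0 < a := ha₀.trans_le ha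
    have hvol : V * b ^ n - V * a ^ n ≤ V * L * (b - a) := by
      rw [← mul_sub, mul_assoc]
      exact mul_le_mul_of_nonneg_left (hLb a b ha0.le hab hb) hV.le
    constructor
    · have h := huw.decRearr_strip_le hΦ hud hn hV hκ hv ha0 hab
      rw [ENNReal.ofReal_one, one_mul] at h
      refine le_trans (ENNReal.ofReal_le_ofReal ?_) (h.trans (by gcongr))
      rw [mul_comm]
      refine mul_le_mul_of_nonneg_left ?_ (sub_nonneg.2 (hanti ha0 hab))
      rw [hc]
      gcongr
    · exact (hud.volume_strip_le hn (by positivity) (by gcongr)).trans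
        (ENNReal.ofReal_le_ofReal hvol)
  rw [absolutelyContinuousOnInterval_iff]
  intro ε hε
  obtain ⟨δ₁, hδ₁, hδ⟩ := exists_pos_setLIntegral_lt_of_measure_lt hfin.ne
    (ε := ENNReal.ofReal (c * ε / 2)) (ENNReal.ofReal_pos.2 (by positivity)).ne'
  obtain ⟨δ₂, hδ₂, hδ₂'⟩ : ∃ δ₂ : ℝ, 0 < δ₂ ∧ ENNReal.ofReal δ₂ ≤ δ₁ := by
    obtain ⟨d, hd, hd'⟩ := ENNReal.lt_iff_exists_nnreal_btwn.1 hδ₁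
    exact ⟨d, by exact_mod_cast hd, by simpa using hd'.le⟩
  refine ⟨min (δ₂ / (V * L)) (c * ε / 2 / (V * L)), by positivity, fun E hE hlen => ?_⟩
  have hlen1 : V * L * ∑ i ∈ Finset.range E.1, dist (E.2 i).1 (E.2 i).2 < δ₂ := by
    rw [mul_comm, ← lt_div_iff₀ (by positivity)]
    exact hlen.trans_le (min_le_left _ _)
  have hlen2 : V * L * ∑ i ∈ Finset.range E.1, dist (E.2 i).1 (E.2 i).2 < c * ε / 2 := by
    rw [mul_comm, ← lt_div_iff₀ (by positivity)]
    exact hlen.trans_le (min_le_right _ _)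
  have hdisj : (Finset.range E.1 : Set ℕ).PairwiseDisjoint fun i => S (E.2 i) := by
    intro i hi j hj hij
    have hd : Disjoint _ _ := hE.2 hi hj hij
    have hi' := hE.1 i hi
    have hj' := hE.1 j hj
    rw [uIcc_of_le hab₀] at hi' hj'
    simp only [uIoc, Set.Ioc_disjoint_Ioc] at hd
    have hpi : 0 < min (E.2 i).1 (E.2 i).2 := ha₀.trans_le (le_min hi'.1.1 hi'.2.1)
    have hpj : 0 < min (E.2 j).1 (E.2 j).2 := ha₀.trans_le (le_min hj'.1.1 hj'.2.1)
    have hli : min (E.2 i).1 (E.2 i).2 ≤ max (E.2 i).1 (E.2 i).2 := min_le_max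
    have hlj : min (E.2 j).1 (E.2 j).2 ≤ max (E.2 j).1 (E.2 j).2 := min_le_max
    refine disjoint_left.2 fun x hx hx' => ?_
    simp only [hS, mem_ofPred_eq] at hx hx'
    generalize min (E.2 i).1 (E.2 i).2 = a at *
    generalize max (E.2 i).1 (E.2 i).2 = b at *
    generalize min (E.2 j).1 (E.2 j).2 = a' at *
    generalize max (E.2 j).1 (E.2 j).2 = b' at *
    rcases min_le_iff.1 hd with h | h <;> rcases le_max_iff.1 h with h' | h'
    · linarith [hanti (hpi.trans_le hli) h', hx.1, hx.2]
    · linarith [hanti (hpi.trans_le hli) h', hx.1, hx.2, hx'.1, hx'.2]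
    · linarith [hanti (hpj.trans_le hlj) h', hx.1, hx.2, hx'.1, hx'.2]
    · linarith [hanti (hpj.trans_le hlj) h', hx'.1, hx'.2]
  have hvolS : volume (⋃ i ∈ Finset.range E.1, S (E.2 i)) < δ₁ := by
    refine (measure_biUnion_finset_le _ _).trans_lt ?_
    refine (Finset.sum_le_sum fun i hi => (key (E.2 i) (hE.1 i hi).1 (hE.1 i hi).2).2).trans_lt ?_
    rw [← ENNReal.ofReal_sum_of_nonneg fun i _ => by positivity, ← Finset.mul_sum]
    exact ((ENNReal.ofReal_lt_ofReal_iff hδ₂).2 hlen1).trans_le hδ₂'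
  have hfinal : ENNReal.ofReal (c * ∑ i ∈ Finset.range E.1, dist (f (E.2 i).1) (f (E.2 i).2)) <
      ENNReal.ofReal (c * ε / 2) + ENNReal.ofReal (c * ε / 2) := by
    rw [Finset.mul_sum, ENNReal.ofReal_sum_of_nonneg fun i _ => by positivity]
    refine (Finset.sum_le_sum fun i hi =>
      (key (E.2 i) (hE.1 i hi).1 (hE.1 i hi).2).1).trans_lt ?_
    rw [Finset.sum_add_distrib, ← lintegral_biUnion_finset hdisj fun i _ => hSm _,
      ← ENNReal.ofReal_sum_of_nonneg fun i _ => by positivity, ← Finset.mul_sum]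
    exact ENNReal.add_lt_add (hδ _ hvolS)
      ((ENNReal.ofReal_lt_ofReal_iff (by positivity)).2 hlen2)
  rw [← ENNReal.ofReal_add (by positivity) (by positivity), add_halves,
    ENNReal.ofReal_lt_ofReal_iff (by positivity)] at hfinal
  exact lt_of_mul_lt_mul_left hfinal hc0.le

end RearrangementAC

section RearrangementEnergy

theorem HasDerivAt.nonneg_of_forall_gt {G : ℝ → ℝ} {G' r : ℝ} (h : HasDerivAt G G' r)
    (hG : ∀ b > r, G r ≤ G b) : 0 ≤ G' := by
  have h1 : Tendsto (slope G r) (𝓝[>] r) (𝓝 G') :=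
    (hasDerivAt_iff_tendsto_slope.1 h).mono_left (nhdsWithin_mono _ fun x hx => ne_of_gt hx)
  refine ge_of_tendsto h1 ?_
  filter_upwards [self_mem_nhdsWithin] with b hb
  rw [slope_def_field]
  exact div_nonneg (sub_nonneg.2 (hG b hb)) (sub_nonneg.2 (le_of_lt hb))

theorem MonotoneOn.lintegral_ofReal_deriv_le {γ : ℝ → ℝ} (hγ : MonotoneOn γ (Ioi 0)) {C : ℝ}
    (h0 : ∀ r > 0, 0 ≤ γ r) (hC : ∀ r > 0, γ r ≤ C) :
    ∫⁻ r in Ioi 0, ENNReal.ofReal (deriv γ r) ≤ ENNReal.ofReal C := by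
  have hU : Ioi (0 : ℝ) = ⋃ k : ℕ, Ioc ((k + 1 : ℝ)⁻¹) (k + 1) := by
    ext r
    simp only [mem_Ioi, mem_iUnion, mem_Ioc]
    constructor
    · intro hr
      obtain ⟨k, hk⟩ := exists_nat_gt (max r⁻¹ r)
      refine ⟨k, ?_, ?_⟩
      · rw [inv_lt_comm₀ (by positivity) hr]
        linarith [le_max_left r⁻¹ r]
      · linarith [le_max_right r⁻¹ r]
    · rintro ⟨k, hk, -⟩
      exact lt_trans (by positivity) hk
  have hmono : Monotone fun k : ℕ => Ioc ((k + 1 : ℝ)⁻¹) (k + 1) := by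
    intro i j hij
    have : (i : ℝ) ≤ j := by exact_mod_cast hij
    exact Ioc_subset_Ioc (inv_anti₀ (by positivity) (by linarith)) (by linarith)
  rw [hU, setLIntegral_iUnion_of_directed _ hmono.directed_le]
  refine iSup_le fun k => ?_
  have ha : (0 : ℝ) < (k + 1 : ℝ)⁻¹ := by positivity
  have hab : (k + 1 : ℝ)⁻¹ ≤ k + 1 := by
    have : (1 : ℝ) ≤ k + 1 := by linarith [(k.cast_nonneg : (0 : ℝ) ≤ k)]
    exact (inv_le_one_of_one_le₀ this).trans this
  have hm : MonotoneOn γ (uIcc ((k + 1 : ℝ)⁻¹) (k + 1)) :=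
    hγ.mono fun x hx => ha.trans_le (by rw [uIcc_of_le hab] at hx; exact hx.1)
  have hi := hm.intervalIntegrable_deriv
  rw [intervalIntegrable_iff_integrableOn_Ioc_of_le hab] at hi
  have hnn : ∀ r ∈ Ioc ((k + 1 : ℝ)⁻¹) (k + 1), 0 ≤ deriv γ r := by
    intro r hr
    rw [← derivWithin_of_isOpen isOpen_Ioi (show r ∈ Ioi 0 from ha.trans hr.1)]
    exact hγ.derivWithin_nonneg
  rw [← ofReal_integral_eq_lintegral_ofReal hi
    ((ae_restrict_iff' measurableSet_Ioc).2 (ae_of_all _ hnn)),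
    ← intervalIntegral.integral_of_le hab]
  refine ENNReal.ofReal_le_ofReal ?_
  have h1 := hm.intervalIntegral_deriv_mem_uIcc
  have h2 := hγ ha (ha.trans_le hab) hab
  rw [uIcc_of_le (sub_nonneg.2 h2)] at h1
  linarith [h1.2, h0 _ ha, hC _ (ha.trans_le hab)]

variable {n : ℕ} {u : Euc n → ℝ}

theorem MemMd.antitoneOn_profile (hu : MemMd u) (hn : 1 ≤ n) {V : ℝ} (hV : 0 < V) :
    AntitoneOn (fun r => decRearr u (V * r ^ n)) (Ioi 0) := fun a ha b _ hab =>
  hu.decRearr_anti hn (by have : 0 < a := ha; positivity)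
    (by have : 0 < a := ha; gcongr)

theorem AntitoneOn.deriv_nonpos_of_pos {f : ℝ → ℝ} (hf : AntitoneOn f (Ioi 0)) {r : ℝ}
    (hr : 0 < r) : deriv f r ≤ 0 := by
  rw [← derivWithin_of_isOpen isOpen_Ioi (show r ∈ Ioi 0 from hr)]
  exact hf.derivWithin_nonpos

/-- A radial energy density dominating the slope of the rearrangement. -/
theorem MemV1d.exists_energy_density {Φ : Euc n → ℝ≥0∞} (hΦ : IsNYoung Φ)
    {g : Euc n → Euc n} (hu : MemV1d Φ u g) (hn : 1 ≤ n) {V : ℝ} (hV : 0 < V) :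
    ∃ e : ℝ → ℝ≥0∞, Measurable e ∧ (∫⁻ r in Ioi 0, e r) ≤ ∫⁻ x, Φ (g x) ∧
      ∀ᵐ r : ℝ, 0 < r → ∀ τ κ : ℝ, 0 < τ → 0 < κ →
        volume {ξ | yconj Φ ξ ≤ ENNReal.ofReal τ} = ENNReal.ofReal (V * κ ^ n) →
        ENNReal.ofReal (n * V * r ^ (n - 1) *
          (κ * -deriv (fun r => decRearr u (V * r ^ n)) r - τ)) ≤ e r := by
  obtain ⟨huw, hud, hfin⟩ := hu
  have hanti := hud.antitoneOn_profile hn hV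
  set f : ℝ → ℝ := fun r => decRearr u (V * r ^ n) with hf
  set γ : ℝ → ℝ := fun r => (∫⁻ x in {x | f r < u x}, Φ (g x)).toReal with hγ
  have hne : ∀ s : Set (Euc n), ∫⁻ x in s, Φ (g x) ≠ ⊤ := fun s =>
    ((setLIntegral_le_lintegral s _).trans_lt hfin).ne
  have hmono : MonotoneOn γ (Ioi 0) := fun a ha b hb hab =>
    ENNReal.toReal_mono (hne _) (lintegral_mono_set fun x hx => (hanti ha hb hab).trans_lt hx)
  refine ⟨fun r => ENNReal.ofReal (deriv γ r), (measurable_deriv γ).ennreal_ofReal, ?_, ?_⟩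
  · refine (hmono.lintegral_ofReal_deriv_le (C := (∫⁻ x, Φ (g x)).toReal)
      (fun r _ => ENNReal.toReal_nonneg) fun r _ =>
      ENNReal.toReal_mono hfin.ne (setLIntegral_le_lintegral _ _)).trans_eq ?_
    rw [ENNReal.ofReal_toReal hfin.ne]
  filter_upwards [hmono.ae_differentiableWithinAt_of_mem,
    hanti.neg.ae_differentiableWithinAt_of_mem] with r h1 h2 hr τ κ hτ hκ hv
  have h1' := ((h1 hr).differentiableAt (Ioi_mem_nhds hr)).hasDerivAt
  have h2'' : HasDerivAt f (deriv f r) r := by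
    have : DifferentiableAt ℝ f r := by
      have := ((h2 hr).differentiableAt (Ioi_mem_nhds hr)).neg
      convert! this using 1
      ext; simp
    exact this.hasDerivAt
  refine ENNReal.ofReal_le_ofReal ?_
  have h3 : HasDerivAt (fun b => γ b + τ * (V * b ^ n) + f b * (n * V * r ^ (n - 1) * κ))
      (deriv γ r + τ * (V * (n * r ^ (n - 1))) + deriv f r * (n * V * r ^ (n - 1) * κ)) r :=
    (h1'.add (((hasDerivAt_pow n r).const_mul V).const_mul τ)).add (h2''.mul_const _)
  have h4 := h3.nonneg_of_forall_gt fun b hb => ?_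
  · linarith
  have hb' : 0 < b := hr.trans hb
  have hs := huw.decRearr_strip_le hΦ hud hn hV hκ hv hr hb.le
  have hsplit : (∫⁻ x in {x | f b < u x ∧ u x < f r}, Φ (g x)) +
      (∫⁻ x in {x | f r < u x}, Φ (g x)) ≤ ∫⁻ x in {x | f b < u x}, Φ (g x) := by
    rw [← lintegral_union (measurableSet_lt measurable_const hud.1)]
    · exact lintegral_mono_set (union_subset (fun x hx => hx.1)
        fun x hx => (hanti hr hb' hb.le).trans_lt hx)
    · exact disjoint_left.2 fun x hx hx' => lt_asymm hx.2 hx'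
  have hpow : 0 ≤ V * b ^ n - V * r ^ n := sub_nonneg.2 (by gcongr)
  rw [← ENNReal.ofReal_mul hτ.le] at hs
  have hs' := ENNReal.toReal_mono (by simp [hne]) hs
  rw [ENNReal.toReal_add (hne _) ENNReal.ofReal_ne_top,
    ENNReal.toReal_ofReal (mul_nonneg hτ.le hpow), ENNReal.toReal_ofReal'] at hs'
  have hsplit' := ENNReal.toReal_mono (hne _) hsplit
  rw [ENNReal.toReal_add (hne _) (hne _)] at hsplit'
  have hs'' := (max_le_iff.1 hs').1
  simp only [hγ]
  linarith

end RearrangementEnergy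

section GaugeMeasure

variable {n : ℕ} {K : Set (Euc n)}

theorem IsConvexBody.mem_nhds_zero (h0 : (0 : Euc n) ∈ interior K) : K ∈ 𝓝 (0 : Euc n) :=
  mem_interior_iff_mem_nhds.1 h0

theorem IsConvexBody.gauge_le_iff (hK : IsConvexBody K) (h0 : (0 : Euc n) ∈ interior K) {r : ℝ}
    (hr : 0 < r) {x : Euc n} : gauge K x ≤ r ↔ x ∈ r • K := by
  have h1 : gauge K x ≤ r ↔ gauge K (r⁻¹ • x) ≤ 1 := by
    rw [gauge_smul_of_nonneg (inv_nonneg.2 hr.le), smul_eq_mul, inv_mul_le_iff₀ hr, mul_one]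
  rw [h1, gauge_le_one_iff_mem_closure hK.2 (IsConvexBody.mem_nhds_zero h0),
    hK.1.isClosed.closure_eq, mem_smul_set_iff_inv_smul_mem₀ hr.ne']

theorem IsConvexBody.gauge_eq_zero_iff (hK : IsConvexBody K) (h0 : (0 : Euc n) ∈ interior K)
    {x : Euc n} : gauge K x = 0 ↔ x = 0 :=
  gauge_eq_zero (absorbent_nhds_zero (IsConvexBody.mem_nhds_zero h0))
    (NormedSpace.isVonNBounded_of_isBounded ℝ hK.1.isBounded)

theorem IsConvexBody.continuous_gauge (hK : IsConvexBody K) (h0 : (0 : Euc n) ∈ interior K) :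
    Continuous (gauge K) :=
  _root_.continuous_gauge hK.2 (IsConvexBody.mem_nhds_zero h0)

theorem IsConvexBody.volume_pos (h0 : (0 : Euc n) ∈ interior K) : 0 < volume K :=
  Measure.measure_pos_of_mem_nhds volume (IsConvexBody.mem_nhds_zero h0)

theorem IsConvexBody.toReal_volume_pos (hK : IsConvexBody K) (h0 : (0 : Euc n) ∈ interior K) :
    0 < (volume K).toReal :=
  ENNReal.toReal_pos (IsConvexBody.volume_pos h0).ne' hK.1.measure_lt_top.ne

theorem IsConvexBody.volume_gauge_le (hK : IsConvexBody K) (h0 : (0 : Euc n) ∈ interior K)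
    {r : ℝ} (hr : 0 < r) :
    volume {x | gauge K x ≤ r} = ENNReal.ofReal ((volume K).toReal * r ^ n) := by
  have e : {x | gauge K x ≤ r} = r • K := by ext x; exact hK.gauge_le_iff h0 hr
  rw [e, Measure.addHaar_smul, finrank_euclideanSpace_fin, abs_of_nonneg (by positivity),
    mul_comm, ENNReal.ofReal_mul ENNReal.toReal_nonneg,
    ENNReal.ofReal_toReal hK.1.measure_lt_top.ne]

theorem lintegral_Ioc_mul_pow (hn : 1 ≤ n) {V a b : ℝ} (hV : 0 ≤ V) (ha : 0 ≤ a) (hab : a ≤ b) :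
    ∫⁻ r in Ioc a b, ENNReal.ofReal (n * V * r ^ (n - 1)) =
      ENNReal.ofReal (V * b ^ n - V * a ^ n) := by
  have hi : IntervalIntegrable (fun r : ℝ => n * V * r ^ (n - 1)) volume a b :=
    Continuous.intervalIntegrable (by fun_prop) _ _
  rw [← ofReal_integral_eq_lintegral_ofReal
    ((intervalIntegrable_iff_integrableOn_Ioc_of_le hab).1 hi)
    ((ae_restrict_iff' measurableSet_Ioc).2 (ae_of_all _ fun r hr => ?_)),
    ← intervalIntegral.integral_of_le hab, intervalIntegral.integral_const_mul, integral_pow]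
  · have : n - 1 + 1 = n := by omega
    have h2 : ((n - 1 : ℕ) : ℝ) + 1 = n := by exact_mod_cast this
    have h3 : (n : ℝ) ≠ 0 := by positivity
    rw [this, h2]
    congr 1
    field_simp
  · have : 0 ≤ r := ha.trans hr.1.le
    show (0 : ℝ) ≤ _
    positivity

theorem IsConvexBody.map_gauge (hK : IsConvexBody K) (h0 : (0 : Euc n) ∈ interior K)
    (hn : 1 ≤ n) : (volume : Measure (Euc n)).map (gauge K) =
      (volume.restrict (Ioi 0)).withDensity
        fun r => ENNReal.ofReal (n * (volume K).toReal * r ^ (n - 1)) := by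
  have hm := (hK.continuous_gauge h0).measurable
  have hle : ∀ r, 0 ≤ r → volume {x | gauge K x ≤ r} =
      ENNReal.ofReal ((volume K).toReal * r ^ n) := by
    intro r hr
    rcases hr.eq_or_lt with rfl | hr
    · have : {x | gauge K x ≤ 0} = {0} := by
        ext x
        simp only [mem_ofPred_eq, mem_singleton_iff]
        rw [← hK.gauge_eq_zero_iff h0]
        exact ⟨fun h => h.antisymm (gauge_nonneg x), fun h => h.le⟩
      have : Nonempty (Fin n) := ⟨⟨0, hn⟩⟩
      rw [‹{x | gauge K x ≤ 0} = {0}›, measure_singleton, zero_pow (by omega)]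
      simp
    · exact hK.volume_gauge_le h0 hr
  have : IsLocallyFiniteMeasure ((volume : Measure (Euc n)).map (gauge K)) := by
    refine ⟨fun r => ⟨Iic (|r| + 1), Iic_mem_nhds (by linarith [le_abs_self r]), ?_⟩⟩
    rw [Measure.map_apply hm measurableSet_Iic]
    exact (hle (|r| + 1) (by positivity)).trans_lt ENNReal.ofReal_lt_top
  refine Measure.ext_of_Ioc _ _ fun a b hab => ?_
  rw [Measure.map_apply hm measurableSet_Ioc, withDensity_apply _ measurableSet_Ioc,
    Measure.restrict_restrict measurableSet_Ioc]
  rcases le_total b 0 with hb | hb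
  · rw [Ioc_inter_Ioi, (Ioc_eq_empty (by simp [hb]) : Ioc (max a 0) b = ∅), setLIntegral_empty]
    rcases hb.eq_or_lt with rfl | hb
    · exact measure_mono_null (fun x hx => hx.2) ((hle 0 le_rfl).trans (by
        rw [zero_pow (by omega)]; simp))
    · exact measure_mono_null (t := ∅) (fun x hx => absurd (gauge_nonneg x)
        (not_le.2 (lt_of_le_of_lt hx.2 hb))) measure_empty
  rw [Ioc_inter_Ioi, lintegral_Ioc_mul_pow hn ENNReal.toReal_nonneg (le_max_right _ _)
    (max_le hab.le hb)]
  rcases le_total 0 a with ha | ha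
  · rw [max_eq_left ha]
    have e : gauge K ⁻¹' Ioc a b = {x | gauge K x ≤ b} \ {x | gauge K x ≤ a} := by
      ext x; simp [and_comm]
    rw [e, measure_sdiff (s₁ := {x | gauge K x ≤ b}) (s₂ := {x | gauge K x ≤ a})
      (fun x (hx : gauge K x ≤ a) => show gauge K x ≤ b from hx.trans hab.le)
      (measurableSet_le hm measurable_const).nullMeasurableSet
      (by rw [hle a ha]; exact ENNReal.ofReal_ne_top),
      hle a ha, hle b hb, ENNReal.ofReal_sub _ (by positivity)]
  · rw [max_eq_right ha, zero_pow (by omega), mul_zero, sub_zero, ← hle b hb]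
    refine le_antisymm (measure_mono fun x hx => hx.2) ?_
    rcases ha.eq_or_lt with rfl | ha
    · have e : {x | gauge K x ≤ b} ⊆ {x | gauge K x ≤ 0} ∪ gauge K ⁻¹' Ioc 0 b := fun x hx =>
        (le_or_gt (gauge K x) 0).imp id fun h => ⟨h, hx⟩
      refine (measure_mono e).trans ((measure_union_le _ _).trans ?_)
      rw [hle 0 le_rfl, zero_pow (by omega)]
      simp
    · exact measure_mono fun x hx => ⟨ha.trans_le (gauge_nonneg x), hx⟩

theorem IsConvexBody.lintegral_comp_gauge (hK : IsConvexBody K) (h0 : (0 : Euc n) ∈ interior K)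
    (hn : 1 ≤ n) {F : ℝ → ℝ≥0∞} (hF : Measurable F) :
    ∫⁻ x, F (gauge K x) =
      ∫⁻ r in Ioi 0, ENNReal.ofReal (n * (volume K).toReal * r ^ (n - 1)) * F r := by
  rw [← lintegral_map hF (hK.continuous_gauge h0).measurable, hK.map_gauge h0 hn,
    lintegral_withDensity_eq_lintegral_mul _ (by fun_prop) hF]
  rfl

theorem IsConvexBody.ae_comp_gauge (hK : IsConvexBody K) (h0 : (0 : Euc n) ∈ interior K)
    (hn : 1 ≤ n) {P : ℝ → Prop} (h : ∀ᵐ r : ℝ, 0 < r → P r) : ∀ᵐ x : Euc n, P (gauge K x) := by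
  refine ae_of_ae_map (hK.continuous_gauge h0).measurable.aemeasurable ?_
  rw [hK.map_gauge h0 hn]
  exact (withDensity_absolutelyContinuous _ _).ae_le ((ae_restrict_iff' measurableSet_Ioi).2 h)

theorem IsConvexBody.volume_gauge_lt (hK : IsConvexBody K) (h0 : (0 : Euc n) ∈ interior K)
    (hn : 1 ≤ n) {r : ℝ} (hr : 0 ≤ r) :
    volume {x | gauge K x < r} = ENNReal.ofReal ((volume K).toReal * r ^ n) := by
  rcases hr.eq_or_lt with rfl | hr
  · rw [(eq_empty_of_forall_notMem fun x hx => (gauge_nonneg x).not_gt hx :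
      {x | gauge K x < 0} = ∅), zero_pow (by omega)]
    simp
  rw [← hK.volume_gauge_le h0 hr]
  refine measure_congr ?_
  have : ∀ᵐ x : Euc n, gauge K x ≠ r := hK.ae_comp_gauge h0 hn (P := fun s => s ≠ r)
    ((Measure.ae_ne volume r).mono fun s hs _ => hs)
  filter_upwards [this] with x hx
  exact propext ⟨fun h => le_of_lt h, fun h => lt_of_le_of_ne h hx⟩

end GaugeMeasure

section Symmetral

variable {n : ℕ} {K : Set (Euc n)} {u : Euc n → ℝ}

theorem lt_funcSymm_iff (hK : IsConvexBody K) (h0 : (0 : Euc n) ∈ interior K) (hn : 1 ≤ n)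
    (hu : MemMd u) {t : ℝ} {x : Euc n} (hx : x ≠ 0) :
    t < funcSymm K u x ↔
      ENNReal.ofReal ((volume K).toReal * gauge K x ^ n) < distFn u t := by
  refine hu.lt_decRearr_iff hn ?_
  have := hK.toReal_volume_pos h0
  have : 0 < gauge K x :=
    lt_of_le_of_ne (gauge_nonneg x) (Ne.symm fun h => hx ((hK.gauge_eq_zero_iff h0).1 h))
  positivity

theorem measurable_funcSymm (hK : IsConvexBody K) (h0 : (0 : Euc n) ∈ interior K) (hn : 1 ≤ n)
    (hu : MemMd u) : Measurable (funcSymm K u) := by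
  refine measurable_of_Ioi fun t => ?_
  have hg := (hK.continuous_gauge h0).measurable
  have e : funcSymm K u ⁻¹' Ioi t = ({0} ∩ funcSymm K u ⁻¹' Ioi t) ∪
      ({0}ᶜ ∩ {x | ENNReal.ofReal ((volume K).toReal * gauge K x ^ n) < distFn u t}) := by
    ext x
    by_cases hx : x = 0
    · simp [hx]
    · simp [hx, lt_funcSymm_iff hK h0 hn hu hx]
  rw [e]
  refine ((finite_singleton 0).subset inter_subset_left).measurableSet.union
    ((measurableSet_singleton 0).compl.inter (measurableSet_lt (by fun_prop) measurable_const))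

theorem distFn_funcSymm (hK : IsConvexBody K) (h0 : (0 : Euc n) ∈ interior K) (hn : 1 ≤ n)
    (hu : MemMd u) (t : ℝ) : distFn (funcSymm K u) t = distFn u t := by
  have : Nonempty (Fin n) := ⟨⟨0, hn⟩⟩
  have hV := hK.toReal_volume_pos h0
  have h1 : distFn (funcSymm K u) t =
      volume {x : Euc n | ENNReal.ofReal ((volume K).toReal * gauge K x ^ n) < distFn u t} := by
    refine measure_congr ?_
    filter_upwards [Measure.ae_ne volume (0 : Euc n)] with x hx
    exact propext (lt_funcSymm_iff hK h0 hn hu hx)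
  rw [h1]
  rcases eq_or_ne (distFn u t) ⊤ with hD | hD
  · rw [hD]
    simp only [ENNReal.ofReal_lt_top]
    simp
  set D := (distFn u t).toReal with hDr
  have hD' : distFn u t = ENNReal.ofReal D := (ENNReal.ofReal_toReal hD).symm
  have hD0 : 0 ≤ D := ENNReal.toReal_nonneg
  have hR : ((D / (volume K).toReal) ^ ((n : ℝ)⁻¹)) ^ n = D / (volume K).toReal :=
    Real.rpow_inv_natCast_pow (by positivity) (by omega)
  set R := (D / (volume K).toReal) ^ ((n : ℝ)⁻¹)
  have hR0 : 0 ≤ R := by positivity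
  have hRD : (volume K).toReal * R ^ n = D := by rw [hR]; field_simp
  rw [hD', ← hRD]
  refine Eq.trans ?_ (hK.volume_gauge_lt h0 hn hR0)
  congr 1
  ext x
  have := gauge_nonneg (s := K) x
  simp only [mem_ofPred_eq]
  rw [ENNReal.ofReal_lt_ofReal_iff', mul_lt_mul_iff_right₀ hV,
    pow_lt_pow_iff_left₀ this hR0 (by omega)]
  refine ⟨fun h => h.1, fun h => ⟨h, ?_⟩⟩
  have := this.trans_lt h
  positivity

theorem MemMd.funcSymm (hK : IsConvexBody K) (h0 : (0 : Euc n) ∈ interior K) (hn : 1 ≤ n)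
    (hu : MemMd u) : MemMd (funcSymm K u) := by
  have : Nonempty (Fin n) := ⟨⟨0, hn⟩⟩
  refine ⟨measurable_funcSymm hK h0 hn hu, fun t ht => ?_⟩
  rw [distFn_funcSymm hK h0 hn hu]
  refine lt_of_le_of_ne le_top fun h => ht.not_ge (le_essInf_of_ae_le _ ?_)
  filter_upwards [Measure.ae_ne volume (0 : Euc n)] with x hx
  rw [EReal.coe_le_coe_iff]
  exact ((lt_funcSymm_iff hK h0 hn hu hx).2 (h ▸ ENNReal.ofReal_lt_top)).le

end Symmetral

section RadialGradient

variable {n : ℕ} {K : Set (Euc n)}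

theorem integral_comp_lipschitz_mul_fderiv {p : Euc n → ℝ} {C : ℝ≥0} (hp : LipschitzWith C p)
    {ψ ψ' : ℝ → ℝ} {B : ℝ≥0} (hψ : ∀ r, HasDerivAt ψ (ψ' r) r) (hB : ∀ r, ‖ψ' r‖₊ ≤ B)
    {φ : Euc n → ℝ} (hφ : ContDiff ℝ (⊤ : ℕ∞) φ) (hφc : HasCompactSupport φ) (w : Euc n) :
    ∫ x, ψ (p x) * fderiv ℝ φ x w = -∫ x, ψ' (p x) * fderiv ℝ p x w * φ x := by
  have hψL : LipschitzWith B ψ := lipschitzWith_of_nnnorm_deriv_le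
    (fun r => (hψ r).differentiableAt) fun r => by rw [(hψ r).deriv]; exact hB r
  obtain ⟨D, hD⟩ := hφ.lipschitzWith_of_hasCompactSupport hφc (by simp)
  have h := (hψL.comp hp).integral_lineDeriv_mul_eq (μ := volume) hD hφc w
  have h1 : ∫ x, lineDeriv ℝ (ψ ∘ p) x w * φ x = ∫ x, ψ' (p x) * fderiv ℝ p x w * φ x := by
    refine integral_congr_ae ?_
    filter_upwards [hp.ae_differentiableAt (μ := volume)] with x hx
    have h2 := (hψ (p x)).comp_hasFDerivAt x hx.hasFDerivAt
    rw [h2.differentiableAt.lineDeriv_eq_fderiv, h2.fderiv]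
    simp
  have h3 : ∫ x, lineDeriv ℝ φ x (-w) * (ψ ∘ p) x = -∫ x, ψ (p x) * fderiv ℝ φ x w := by
    rw [← integral_neg]
    refine integral_congr_ae (ae_of_all _ fun x => ?_)
    have : DifferentiableAt ℝ φ x := hφ.differentiable (by simp) x
    simp only [this.lineDeriv_eq_fderiv, map_neg, Function.comp_apply]
    ring
  rw [h1, h3] at h
  rw [h, neg_neg]

theorem IsConvexBody.lintegral_tail_le (hK : IsConvexBody K) (h0 : (0 : Euc n) ∈ interior K)
    (hn : 1 ≤ n) {F : ℝ → ℝ≥0∞} (hF : Measurable F) (R : ℝ) :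
    ∫⁻ x in {x | gauge K x ≤ R}, ∫⁻ s in Ioc (gauge K x) R, F s ≤
      ENNReal.ofReal R * ∫⁻ x in {x | gauge K x ≤ R}, F (gauge K x) := by
  have hm := (hK.continuous_gauge h0).measurable
  have hV := hK.toReal_volume_pos h0
  have hset : MeasurableSet {q : Euc n × ℝ | gauge K q.1 < q.2 ∧ q.2 ≤ R} :=
    (measurableSet_lt (hm.comp measurable_fst) measurable_snd).inter
      (measurableSet_le measurable_snd measurable_const)
  set G : Euc n → ℝ → ℝ≥0∞ := fun x s =>
    {q : Euc n × ℝ | gauge K q.1 < q.2 ∧ q.2 ≤ R}.indicator (fun q => F q.2) (x, s) with hG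
  have hGm : Measurable (Function.uncurry G) := (hF.comp measurable_snd).indicator hset
  calc ∫⁻ x in {x | gauge K x ≤ R}, ∫⁻ s in Ioc (gauge K x) R, F s
      ≤ ∫⁻ x, ∫⁻ s in Ioc (gauge K x) R, F s := setLIntegral_le_lintegral _ _
    _ = ∫⁻ x, ∫⁻ s, G x s := by
        refine lintegral_congr fun x => ?_
        rw [← lintegral_indicator measurableSet_Ioc]
        rfl
    _ = ∫⁻ s, ∫⁻ x, G x s := lintegral_lintegral_swap hGm.aemeasurable
    _ ≤ ∫⁻ s in Ioi 0, ENNReal.ofReal (n * (volume K).toReal * s ^ (n - 1)) *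
          (ENNReal.ofReal R * (Iic R).indicator F s) := by
        rw [← lintegral_indicator measurableSet_Ioi]
        refine lintegral_mono fun s => ?_
        by_cases hs : s ∈ Ioi (0 : ℝ)
        · rw [indicator_of_mem hs]
          by_cases hsR : s ∈ Iic R
          · have hs' : (0 : ℝ) < s := hs
            have hsR' : s ≤ R := hsR
            have e : ∀ x, G x s = {x | gauge K x < s}.indicator (fun _ => F s) x := by
              intro x
              by_cases hx : gauge K x < s
              · simp [hG, hx, hsR']
              · simp [hG, hx]
            simp_rw [e]
            rw [lintegral_indicator_const (measurableSet_lt hm measurable_const),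
              hK.volume_gauge_lt h0 hn hs'.le, indicator_of_mem hsR, mul_comm (F s), ← mul_assoc,
              ← ENNReal.ofReal_mul (by positivity)]
            refine mul_le_mul' (ENNReal.ofReal_le_ofReal ?_) le_rfl
            have e1 : s ^ n = s ^ (n - 1) * s := by rw [← pow_succ]; congr 1; omega
            have h1 : (1 : ℝ) ≤ n := by exact_mod_cast hn
            rw [e1]
            calc (volume K).toReal * (s ^ (n - 1) * s)
                = 1 * ((volume K).toReal * s ^ (n - 1)) * s := by ring
              _ ≤ n * ((volume K).toReal * s ^ (n - 1)) * R := by gcongr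
              _ = _ := by ring
          · have e : ∀ x, G x s = 0 := fun x => indicator_of_notMem (fun h => hsR h.2) _
            simp [e]
        · have e : ∀ x, G x s = 0 := fun x =>
            indicator_of_notMem (fun h => hs ((gauge_nonneg x).trans_lt h.1)) _
          simp [e]
    _ = ENNReal.ofReal R * ∫⁻ x in {x | gauge K x ≤ R}, F (gauge K x) := by
        rw [← hK.lintegral_comp_gauge h0 hn ((hF.indicator measurableSet_Iic).const_mul _),
          lintegral_const_mul _ (show Measurable fun x => (Iic R).indicator F (gauge K x) from
            (hF.indicator measurableSet_Iic).comp hm),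
          ← lintegral_indicator (measurableSet_le hm measurable_const)]
        rfl

theorem IsConvexBody.ae_intervalIntegrable_tail (hK : IsConvexBody K)
    (h0 : (0 : Euc n) ∈ interior K) (hn : 1 ≤ n) {ζ : ℝ → ℝ} (hζ : Measurable ζ) {R : ℝ}
    (h : ∫⁻ x in {x | gauge K x ≤ R}, ‖ζ (gauge K x)‖ₑ ≠ ⊤) :
    ∀ᵐ x ∂volume.restrict {x | gauge K x ≤ R},
      IntervalIntegrable ζ volume (gauge K x) R := by
  have hm := (hK.continuous_gauge h0).measurable
  have h1 := hK.lintegral_tail_le h0 hn hζ.enorm R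
  have h2 : AEMeasurable (fun x => ∫⁻ s in Ioc (gauge K x) R, ‖ζ s‖ₑ)
      (volume.restrict {x | gauge K x ≤ R}) := by
    have hset : MeasurableSet {q : Euc n × ℝ | gauge K q.1 < q.2 ∧ q.2 ≤ R} :=
      (measurableSet_lt (hm.comp measurable_fst) measurable_snd).inter
        (measurableSet_le measurable_snd measurable_const)
    have h3 := ((hζ.enorm.comp (measurable_snd (α := Euc n))).indicator hset).lintegral_prod_right'
      (ν := volume)
    refine h3.aemeasurable.congr (ae_of_all _ fun x => ?_)
    dsimp only
    rw [← lintegral_indicator measurableSet_Ioc]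
    rfl
  have h3 := ae_lt_top' h2 (h1.trans_lt (ENNReal.mul_lt_top ENNReal.ofReal_lt_top h.lt_top)).ne
  filter_upwards [h3, ae_restrict_mem (measurableSet_le hm measurable_const)] with x hx hxR
  rw [intervalIntegrable_iff_integrableOn_Ioc_of_le hxR]
  exact ⟨hζ.aestronglyMeasurable, hx⟩

theorem enorm_intervalIntegral_le_lintegral {ζ : ℝ → ℝ} {a b : ℝ} (hab : a ≤ b) :
    ‖∫ s in a..b, ζ s‖ₑ ≤ ∫⁻ s in Ioc a b, ‖ζ s‖ₑ := by
  rw [intervalIntegral.integral_of_le hab]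
  exact enorm_integral_le_lintegral_enorm _

end RadialGradient

section RadialWeakGradient

variable {n : ℕ} {K : Set (Euc n)}

theorem integrable_mul_of_bdd_of_eq_zero {α : Type*} [MeasurableSpace α] {μ : Measure α}
    {S : Set α} {g h : α → ℝ} {C : ℝ≥0} (hg : IntegrableOn g S μ)
    (hh : Measurable h) (hC : ∀ x, ‖h x‖ₑ ≤ C) (h0 : ∀ x ∉ S, h x = 0) :
    Integrable (fun x => g x * h x) μ := by
  have h1 : IntegrableOn (fun x => g x * h x) S μ := by
    refine Integrable.mul_bdd (c := C) hg hh.aestronglyMeasurable (ae_of_all _ fun x => ?_)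
    have := hC x
    rw [← ofReal_norm] at this
    simpa using (ENNReal.ofReal_le_iff_le_toReal ENNReal.coe_ne_top).1 this
  exact h1.integrable_of_forall_notMem_eq_zero fun x hx => by simp [h0 x hx]

theorem IsConvexBody.isCompact_gauge_le (hK : IsConvexBody K) (h0 : (0 : Euc n) ∈ interior K)
    {R : ℝ} (hR : 0 < R) : IsCompact {x | gauge K x ≤ R} := by
  have : {x | gauge K x ≤ R} = R • K := by
    ext x
    exact hK.gauge_le_iff h0 hR
  rw [this]
  exact hK.1.smul R

theorem IsConvexBody.exists_gauge_lt_of_isCompact (hK : IsConvexBody K)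
    (h0 : (0 : Euc n) ∈ interior K) {k : Set (Euc n)} (hk : IsCompact k) :
    ∃ R > 0, ∀ x ∈ k, gauge K x < R := by
  obtain ⟨R, hR⟩ := (hk.image (hK.continuous_gauge h0)).bddAbove
  refine ⟨max R 0 + 1, by positivity, fun x hx => ?_⟩
  have := hR (mem_image_of_mem _ hx)
  have := le_max_left R 0
  linarith

variable {f η : ℝ → ℝ}

theorem IsConvexBody.integrableOn_comp_gauge (hK : IsConvexBody K)
    (h0 : (0 : Euc n) ∈ interior K) (hn : 1 ≤ n) (hη : Measurable η)
    (hf : Measurable fun x => f (gauge K x))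
    (hηint : ∀ R, ∫⁻ x in {x | gauge K x ≤ R}, ‖η (gauge K x)‖ₑ ≠ ⊤)
    (hftc : ∀ a b, 0 < a → a ≤ b → f a - f b = ∫ s in a..b, η s) {R : ℝ} (hR : 0 < R) :
    IntegrableOn (fun x => f (gauge K x)) {x | gauge K x ≤ R} := by
  have hm := (hK.continuous_gauge h0).measurable
  have hfin : volume {x | gauge K x ≤ R} ≠ ⊤ := (hK.isCompact_gauge_le h0 hR).measure_lt_top.ne
  have h1 : IntegrableOn (fun x => f (gauge K x) - f R) {x | gauge K x ≤ R} := by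
    refine ⟨(hf.sub_const _).aestronglyMeasurable, ?_⟩
    refine lt_of_le_of_lt (lintegral_mono_ae ?_) ((hK.lintegral_tail_le h0 hn hη.enorm R).trans_lt
      (ENNReal.mul_lt_top ENNReal.ofReal_lt_top (hηint R).lt_top))
    have hpos : ∀ᵐ x, 0 < gauge K x := hK.ae_comp_gauge h0 hn (P := fun r => 0 < r)
      (ae_of_all _ fun r hr => hr)
    filter_upwards [ae_restrict_of_ae hpos, ae_restrict_mem (measurableSet_le hm measurable_const)]
      with x hx hxR
    rw [hftc _ _ hx hxR]
    exact enorm_intervalIntegral_le_lintegral hxR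
  have h2 := h1.add (integrableOn_const (C := f R) hfin)
  exact h2.congr_fun (fun x _ => by simp) (measurableSet_le hm measurable_const)

theorem IsConvexBody.integral_comp_gauge_mul_fderiv (hK : IsConvexBody K)
    (h0 : (0 : Euc n) ∈ interior K) (hn : 1 ≤ n) (hη : Measurable η)
    (hf : Measurable fun x => f (gauge K x))
    (hηint : ∀ R, ∫⁻ x in {x | gauge K x ≤ R}, ‖η (gauge K x)‖ₑ ≠ ⊤)
    (hftc : ∀ a b, 0 < a → a ≤ b → f a - f b = ∫ s in a..b, η s)
    {φ : Euc n → ℝ} (hφ : ContDiff ℝ (⊤ : ℕ∞) φ) (hφc : HasCompactSupport φ) (w : Euc n) :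
    ∫ x, f (gauge K x) * fderiv ℝ φ x w =
      ∫ x, η (gauge K x) * (fderiv ℝ (gauge K) x w * φ x) := by
  have hm := (hK.continuous_gauge h0).measurable
  obtain ⟨L, hL⟩ := hK.2.lipschitz_gauge (IsConvexBody.mem_nhds_zero h0)
  obtain ⟨R, hR, hRφ⟩ := hK.exists_gauge_lt_of_isCompact h0 hφc.isCompact
  set S : Set (Euc n) := {x | gauge K x ≤ R} with hS
  have hSm : MeasurableSet S := measurableSet_le hm measurable_const
  have hSfin : volume S ≠ ⊤ := (hK.isCompact_gauge_le h0 hR).measure_lt_top.ne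
  have hSφ : ∀ x ∉ S, x ∉ tsupport φ := fun x hx h => hx (hRφ x h).le
  set D : Euc n → ℝ := fun x => fderiv ℝ φ x w with hD
  set E : Euc n → ℝ := fun x => fderiv ℝ (gauge K) x w * φ x with hE
  have hDcont : Continuous D := (hφ.continuous_fderiv (by simp)).clm_apply continuous_const
  have hD0 : ∀ x ∉ S, D x = 0 := fun x hx => by
    have : fderiv ℝ φ x = 0 := by
      by_contra h
      exact hSφ x hx (support_fderiv_subset ℝ h)
    simp [hD, this]
  have hE0 : ∀ x ∉ S, E x = 0 := fun x hx => by
    simp [hE, image_eq_zero_of_notMem_tsupport (hSφ x hx)]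
  have hEm : Measurable E :=
    (measurable_fderiv_apply_const ℝ (gauge K) w).mul hφ.continuous.measurable
  have hDc : HasCompactSupport D := hφc.fderiv_apply (𝕜 := ℝ) w
  obtain ⟨C₁, hC₁⟩ : ∃ C : ℝ≥0, ∀ x, ‖D x‖ₑ ≤ C := by
    obtain ⟨C, hC⟩ := hDc.exists_bound_of_continuous hDcont
    refine ⟨C.toNNReal, fun x => ?_⟩
    rw [← ofReal_norm]
    exact ENNReal.ofReal_le_ofReal (hC x)
  obtain ⟨C₂, hC₂⟩ : ∃ C : ℝ≥0, ∀ x, ‖E x‖ₑ ≤ C := by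
    obtain ⟨C, hC⟩ := hφc.exists_bound_of_continuous hφ.continuous
    refine ⟨(L * ‖w‖ * C).toNNReal, fun x => ?_⟩
    rw [← ofReal_norm]
    refine ENNReal.ofReal_le_ofReal ?_
    rw [hE, norm_mul]
    refine mul_le_mul ?_ (hC x) (norm_nonneg _) (by positivity)
    exact (ContinuousLinearMap.le_opNorm _ _).trans
      (mul_le_mul_of_nonneg_right (norm_fderiv_le_of_lipschitz ℝ hL) (norm_nonneg _))
  have hfS := hK.integrableOn_comp_gauge h0 hn hη hf hηint hftc hR
  have hηS : IntegrableOn (fun x => η (gauge K x)) S :=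
    ⟨(hη.comp hm).aestronglyMeasurable, (hηint R).lt_top⟩
  have hDint : ∫ x, D x = 0 := by
    have := integral_comp_lipschitz_mul_fderiv (n := n) (p := gauge K) hL (ψ := fun _ => 1)
      (ψ' := fun _ => 0) (B := 0) (fun r => hasDerivAt_const _ _) (by simp) hφ hφc w
    simpa using this
  have hDi : Integrable D := hDcont.integrable_of_hasCompactSupport hDc
  have hI1 := integrable_mul_of_bdd_of_eq_zero hfS hDcont.measurable hC₁ hD0
  have hI2 := integrable_mul_of_bdd_of_eq_zero hηS hEm hC₂ hE0
  have key : ∀ ε : ℝ≥0, ε ≠ 0 →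
      ‖(∫ x, f (gauge K x) * D x) - ∫ x, η (gauge K x) * E x‖ₑ ≤
        C₁ * (ENNReal.ofReal R * ε) + C₂ * ε := by
    intro ε hε
    set ν : Measure ℝ := (volume.restrict S).map (gauge K) with hν
    have : IsFiniteMeasure (volume.restrict S) := ⟨by simpa using hSfin.lt_top⟩
    have hην : Integrable η ν :=
      (integrable_map_measure hη.aestronglyMeasurable hm.aemeasurable).2 hηS
    obtain ⟨ζ, hζc, hζε, hζ, -⟩ := hην.exists_hasCompactSupport_lintegral_sub_le
      (ε := (ε : ℝ≥0∞)) (by simpa using hε)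
    have hsub : Measurable fun s => η s - ζ s := hη.sub hζ.measurable
    rw [hν, lintegral_map hsub.enorm hm] at hζε
    obtain ⟨B, hB⟩ := hζc.exists_bound_of_continuous hζ
    set ψ : ℝ → ℝ := fun r => ∫ s in r..R, ζ s with hψ
    have hψd : ∀ r, HasDerivAt ψ (-ζ r) r := fun r =>
      intervalIntegral.integral_hasDerivAt_left (hζ.intervalIntegrable _ _)
        (hζ.stronglyMeasurableAtFilter _ _) hζ.continuousAt
    have hψc : Continuous ψ := continuous_iff_continuousAt.2 fun r => (hψd r).continuousAt
    have hpc := hK.continuous_gauge h0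
    have hψS : IntegrableOn (fun x => ψ (gauge K x)) S :=
      (hψc.comp hpc).continuousOn.integrableOn_compact (hK.isCompact_gauge_le h0 hR)
    have hζS : IntegrableOn (fun x => ζ (gauge K x)) S :=
      (hζ.comp hpc).continuousOn.integrableOn_compact (hK.isCompact_gauge_le h0 hR)
    have hI3 := integrable_mul_of_bdd_of_eq_zero hψS hDcont.measurable hC₁ hD0
    have hI4 := integrable_mul_of_bdd_of_eq_zero hζS hEm hC₂ hE0
    have hibp : ∫ x, ψ (gauge K x) * D x = ∫ x, ζ (gauge K x) * E x := by
      rw [integral_comp_lipschitz_mul_fderiv hL hψd (B := B.toNNReal) (fun r => ?_) hφ hφc w,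
        ← integral_neg]
      · refine integral_congr_ae (ae_of_all _ fun x => ?_)
        simp only [hE]
        ring
      · rw [nnnorm_neg, ← NNReal.coe_le_coe, coe_nnnorm]
        exact (hB r).trans (Real.le_coe_toNNReal _)
    have hrew : (∫ x, f (gauge K x) * D x) - ∫ x, η (gauge K x) * E x =
        ∫ x, ((f (gauge K x) - f R - ψ (gauge K x)) * D x -
          (η (gauge K x) - ζ (gauge K x)) * E x) := by
      have e : ∀ x, ((f (gauge K x) - f R - ψ (gauge K x)) * D x -
          (η (gauge K x) - ζ (gauge K x)) * E x) = (f (gauge K x) * D x - f R * D x -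
            (ψ (gauge K x) * D x)) - (η (gauge K x) * E x - ζ (gauge K x) * E x) :=
        fun x => by ring
      simp_rw [e]
      have h1 : Integrable fun x => f (gauge K x) * D x - f R * D x := hI1.sub (hDi.const_mul _)
      have h2 : Integrable fun x => f (gauge K x) * D x - f R * D x - ψ (gauge K x) * D x :=
        h1.sub hI3
      have h3 : Integrable fun x => η (gauge K x) * E x - ζ (gauge K x) * E x := hI2.sub hI4
      rw [integral_sub h2 h3, integral_sub h1 hI3, integral_sub hI1 (hDi.const_mul _),
        integral_sub hI2 hI4, integral_const_mul, hDint, hibp]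
      ring
    have hζε' : ∫⁻ x in {x | gauge K x ≤ R}, ‖η (gauge K x) - ζ (gauge K x)‖ₑ ≤ ε := hζε
    have htail := hK.lintegral_tail_le h0 hn hsub.enorm R
    have hpos : ∀ᵐ x, 0 < gauge K x := hK.ae_comp_gauge h0 hn (P := fun r => 0 < r)
      (ae_of_all _ fun r hr => hr)
    rw [hrew]
    calc _ ≤ ∫⁻ x, ‖(f (gauge K x) - f R - ψ (gauge K x)) * D x -
          (η (gauge K x) - ζ (gauge K x)) * E x‖ₑ := enorm_integral_le_lintegral_enorm _
      _ = ∫⁻ x in S, ‖(f (gauge K x) - f R - ψ (gauge K x)) * D x -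
          (η (gauge K x) - ζ (gauge K x)) * E x‖ₑ := by
          rw [← lintegral_indicator hSm]
          refine lintegral_congr fun x => ?_
          by_cases hx : x ∈ S
          · rw [indicator_of_mem hx]
          · rw [indicator_of_notMem hx]
            simp [hD0 x hx, hE0 x hx]
      _ ≤ ∫⁻ x in S, (C₁ * (∫⁻ s in Ioc (gauge K x) R, ‖η s - ζ s‖ₑ) +
          C₂ * ‖η (gauge K x) - ζ (gauge K x)‖ₑ) := by
          refine lintegral_mono_ae ?_
          filter_upwards [hK.ae_intervalIntegrable_tail h0 hn hη (hηint R),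
            ae_restrict_of_ae hpos, ae_restrict_mem hSm] with x hx hx0 hxR
          refine (enorm_sub_le).trans ?_
          rw [enorm_mul, enorm_mul, mul_comm (C₁ : ℝ≥0∞), mul_comm (C₂ : ℝ≥0∞)]
          refine add_le_add (mul_le_mul' ?_ (hC₁ x)) (mul_le_mul' le_rfl (hC₂ x))
          rw [hftc _ _ hx0 hxR, hψ, ← intervalIntegral.integral_sub hx (hζ.intervalIntegrable _ _)]
          exact enorm_intervalIntegral_le_lintegral hxR
      _ = C₁ * (∫⁻ x in S, ∫⁻ s in Ioc (gauge K x) R, ‖η s - ζ s‖ₑ) +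
          C₂ * ∫⁻ x in S, ‖η (gauge K x) - ζ (gauge K x)‖ₑ := by
          rw [lintegral_add_right _ ((show Measurable fun x => ‖η (gauge K x) - ζ (gauge K x)‖ₑ from
            (hsub.comp hm).enorm).const_mul _),
            lintegral_const_mul' _ _ ENNReal.coe_ne_top,
            lintegral_const_mul' _ _ ENNReal.coe_ne_top]
      _ ≤ _ := by
          refine add_le_add (mul_le_mul' le_rfl (htail.trans ?_)) (mul_le_mul' le_rfl hζε')
          exact mul_le_mul' le_rfl hζε'
  have hz : ‖(∫ x, f (gauge K x) * D x) - ∫ x, η (gauge K x) * E x‖ₑ ≤ 0 := by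
    have hlim : Tendsto (fun ε : ℝ≥0 => (C₁ : ℝ≥0∞) * (ENNReal.ofReal R * ε) + C₂ * ε)
        (𝓝[>] 0) (𝓝 0) := by
      have hc : Continuous fun ε : ℝ≥0 => C₁ * (R.toNNReal * ε) + C₂ * ε := by fun_prop
      have h2 := (ENNReal.continuous_coe.comp hc).tendsto 0
      simp only [Function.comp_apply, mul_zero, add_zero, ENNReal.coe_zero] at h2
      refine (h2.mono_left nhdsWithin_le_nhds).congr fun ε => ?_
      simp [ENNReal.ofReal]
    exact ge_of_tendsto hlim (by
      filter_upwards [self_mem_nhdsWithin] with ε hε using key ε (ne_of_gt hε))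
  rw [nonpos_iff_eq_zero, enorm_eq_zero, sub_eq_zero] at hz
  exact hz

theorem IsConvexBody.hasWeakGradient_comp_gauge (hK : IsConvexBody K)
    (h0 : (0 : Euc n) ∈ interior K) (hn : 1 ≤ n) (hη : Measurable η)
    (hf : Measurable fun x => f (gauge K x))
    (hηint : ∀ R, ∫⁻ x in {x | gauge K x ≤ R}, ‖η (gauge K x)‖ₑ ≠ ⊤)
    (hftc : ∀ a b, 0 < a → a ≤ b → f a - f b = ∫ s in a..b, η s) :
    HasWeakGradient (fun x => f (gauge K x))
      (fun x => (-η (gauge K x)) • gradient (gauge K) x) := by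
  have hm := (hK.continuous_gauge h0).measurable
  obtain ⟨L, hL⟩ := hK.2.lipschitz_gauge (IsConvexBody.mem_nhds_zero h0)
  refine ⟨?_, ?_, fun φ hφ hφc w => ?_⟩
  · refine locallyIntegrable_iff.2 fun k hk => ?_
    obtain ⟨R, hR, hkR⟩ := hK.exists_gauge_lt_of_isCompact h0 hk
    exact (hK.integrableOn_comp_gauge h0 hn hη hf hηint hftc hR).mono_set
      fun x hx => (hkR x hx).le
  · refine locallyIntegrable_iff.2 fun k hk => ?_
    obtain ⟨R, hR, hkR⟩ := hK.exists_gauge_lt_of_isCompact h0 hk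
    have hηS : IntegrableOn (fun x => -η (gauge K x)) {x | gauge K x ≤ R} :=
      Integrable.neg ⟨(hη.comp hm).aestronglyMeasurable, (hηint R).lt_top⟩
    refine IntegrableOn.mono_set ?_ fun x hx => (hkR x hx).le
    have hgm : Measurable (gradient (gauge K)) :=
      (InnerProductSpace.toDual ℝ (Euc n)).symm.continuous.measurable.comp (measurable_fderiv ℝ _)
    refine Integrable.smul_bdd hηS L hgm.aestronglyMeasurable (ae_of_all _ fun x => ?_)
    rw [gradient, LinearIsometryEquiv.norm_map]
    exact norm_fderiv_le_of_lipschitz ℝ hL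
  · rw [hK.integral_comp_gauge_mul_fderiv h0 hn hη hf hηint hftc hφ hφc w, ← integral_neg]
    refine integral_congr_ae (ae_of_all _ fun x => ?_)
    simp only [inner_smul_left, inner_gradient_left]
    simp
    ring

end RadialWeakGradient

section PolyaSzego

variable {n : ℕ} {K : Set (Euc n)} {u : Euc n → ℝ}

theorem fderiv_gauge_le (hc : Convex ℝ K) (ha : Absorbent ℝ K) {x : Euc n}
    (hx : DifferentiableAt ℝ (gauge K) x) (z : Euc n) : fderiv ℝ (gauge K) x z ≤ gauge K z := by
  have h1 : HasDerivAt (fun t : ℝ => gauge K (x + t • z)) (fderiv ℝ (gauge K) x z) 0 :=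
    (hx.hasFDerivAt.hasLineDerivAt z)
  have h2 : HasDerivAt (fun t : ℝ => t * gauge K z - gauge K (x + t • z))
      (1 * gauge K z - fderiv ℝ (gauge K) x z) 0 := ((hasDerivAt_id 0).mul_const _).sub h1
  have h3 := h2.nonneg_of_forall_gt fun b hb => by
    have h4 := gauge_add_le hc ha x (b • z)
    rw [gauge_smul_of_nonneg (le_of_lt hb)] at h4
    simp only [zero_smul, zero_mul, add_zero, smul_eq_mul] at h4 ⊢
    linarith
  linarith

theorem enorm_mul_le_energy_density {c κ δ : ℝ} {e : ℝ≥0∞} (hc : 0 ≤ c) (hκ : 0 ≤ κ) (hδ : 0 ≤ δ)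
    (h : ENNReal.ofReal (c * (κ * δ - 1)) ≤ e) :
    ENNReal.ofReal κ * (ENNReal.ofReal c * ‖δ‖ₑ) ≤ e + ENNReal.ofReal c := by
  rw [Real.enorm_of_nonneg hδ, ← ENNReal.ofReal_mul hc, ← ENNReal.ofReal_mul hκ]
  calc ENNReal.ofReal (κ * (c * δ)) = ENNReal.ofReal (c * (κ * δ - 1) + c) := by ring_nf
    _ ≤ _ := ENNReal.ofReal_add_le.trans (add_le_add h le_rfl)

theorem MemV1d.lintegral_deriv_profile_ne_top {Φ : Euc n → ℝ≥0∞} (hΦ : IsNYoung Φ)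
    {g : Euc n → Euc n} (hu : MemV1d Φ u g) (hn : 1 ≤ n) (hK : IsConvexBody K)
    (h0 : (0 : Euc n) ∈ interior K) (R : ℝ) :
    ∫⁻ x in {x | gauge K x ≤ R},
      ‖-deriv (fun r => decRearr u ((volume K).toReal * r ^ n)) (gauge K x)‖ₑ ≠ ⊤ := by
  have hm := (hK.continuous_gauge h0).measurable
  have hV := hK.toReal_volume_pos h0
  set V := (volume K).toReal with hVdef
  set η : ℝ → ℝ := fun r => -deriv (fun r => decRearr u (V * r ^ n)) r with hη
  have hηm : Measurable η := (measurable_deriv _).neg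
  obtain ⟨e, -, hle, he⟩ := hu.exists_energy_density hΦ hn hV
  obtain ⟨κ, hκ, hv⟩ := hΦ.exists_volume_yconj_le_eq hn one_pos hV
  have hanti := hu.2.1.antitoneOn_profile hn hV
  rcases le_or_gt R 0 with hR | hR
  · have : Nonempty (Fin n) := ⟨⟨0, hn⟩⟩
    have : volume {x : Euc n | gauge K x ≤ R} = 0 := by
      refine measure_mono_null (fun x hx => ?_) (measure_singleton (μ := volume) (0 : Euc n))
      have hx' : gauge K x ≤ R := hx
      exact (hK.gauge_eq_zero_iff h0).1 (le_antisymm (hx'.trans hR) (gauge_nonneg x))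
    rw [Measure.restrict_eq_zero.2 this]
    simp
  have hS : MeasurableSet {x : Euc n | gauge K x ≤ R} := measurableSet_le hm measurable_const
  have h1 := hK.lintegral_comp_gauge h0 hn (hηm.enorm.indicator (measurableSet_Iic (a := R)))
  have h2 := hK.lintegral_comp_gauge h0 hn
    ((measurable_const (a := (1 : ℝ≥0∞))).indicator (measurableSet_Iic (a := R)))
  have h3 : ∫⁻ x, (Iic R).indicator (fun _ => (1 : ℝ≥0∞)) (gauge K x) =
      volume {x | gauge K x ≤ R} := by
    rw [← lintegral_indicator_one hS]
    rfl
  have h4 : ∫⁻ x, (Iic R).indicator (fun r => ‖η r‖ₑ) (gauge K x) =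
      ∫⁻ x in {x | gauge K x ≤ R}, ‖η (gauge K x)‖ₑ := by
    rw [← lintegral_indicator hS]
    rfl
  have key : ENNReal.ofReal κ * ∫⁻ x in {x | gauge K x ≤ R}, ‖η (gauge K x)‖ₑ ≤
      (∫⁻ r in Ioi 0, e r) + volume {x | gauge K x ≤ R} := by
    have hc : Measurable fun r : ℝ => ENNReal.ofReal (n * V * r ^ (n - 1)) *
        (Iic R).indicator (fun _ => (1 : ℝ≥0∞)) r :=
      Measurable.mul (by fun_prop) (measurable_const.indicator measurableSet_Iic)
    rw [← h4, h1, ← h3, h2, ← lintegral_const_mul' _ _ ENNReal.ofReal_ne_top,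
      ← lintegral_add_right _ hc]
    refine lintegral_mono_ae ((ae_restrict_iff' measurableSet_Ioi).2 ?_)
    filter_upwards [he] with r hr hr0
    have hr0' : 0 < r := hr0
    by_cases hrR : r ∈ Iic R
    · rw [indicator_of_mem hrR, indicator_of_mem hrR, mul_one]
      exact enorm_mul_le_energy_density (by positivity) hκ.le
        (neg_nonneg.2 (hanti.deriv_nonpos_of_pos hr0)) (hr hr0 1 κ one_pos hκ hv)
    · simp [indicator_of_notMem hrR]
  have hfin : (∫⁻ r in Ioi 0, e r) + volume {x | gauge K x ≤ R} ≠ ⊤ :=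
    ENNReal.add_ne_top.2 ⟨(hle.trans_lt hu.2.2).ne,
      (hK.isCompact_gauge_le h0 hR).measure_lt_top.ne⟩
  exact (ENNReal.lt_top_of_mul_ne_top_right (ne_top_of_le_ne_top hfin key)
    (ENNReal.ofReal_pos.2 hκ).ne').ne

theorem yconj_youngSymm_gradient_le {Φ : Euc n → ℝ≥0∞} (hΦ : IsNYoung Φ) (hn : 1 ≤ n)
    (hK : IsConvexBody K) (h0 : (0 : Euc n) ∈ interior K) {x : Euc n}
    (hx : DifferentiableAt ℝ (gauge K) x) {c δ : ℝ} {e : ℝ≥0∞} (hc : 0 < c) (hδ : 0 ≤ δ)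
    (h : ∀ τ κ : ℝ, 0 < τ → 0 < κ →
      volume {ξ | yconj Φ ξ ≤ ENNReal.ofReal τ} = ENNReal.ofReal ((volume K).toReal * κ ^ n) →
        ENNReal.ofReal (c * (κ * δ - τ)) ≤ e) :
    yconj (youngSymm K (yconj Φ)) ((-δ) • gradient (gauge K) x) ≤ e / ENNReal.ofReal c := by
  have hV := hK.toReal_volume_pos h0
  refine yconj_le_iff.2 fun ζ => ?_
  rcases eq_or_ne (youngSymm K (yconj Φ) ζ) ⊤ with htop | htop
  · simp [htop]
  refine ENNReal.le_of_forall_pos_le_add fun ε hε _ => ?_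
  set τ : ℝ := (youngSymm K (yconj Φ) ζ).toReal + ε with hτ
  have hτ0 : 0 < τ := by positivity
  have hτ' : ENNReal.ofReal τ = youngSymm K (yconj Φ) ζ + ε := by
    rw [hτ, ENNReal.ofReal_add ENNReal.toReal_nonneg ε.coe_nonneg, ENNReal.ofReal_toReal htop,
      ENNReal.ofReal_coe_nnreal]
  obtain ⟨κ, hκ, hv⟩ := hΦ.exists_volume_yconj_le_eq hn hτ0 hV
  have hlt : youngSymm K (yconj Φ) ζ < ENNReal.ofReal τ := by
    rw [hτ']
    exact ENNReal.lt_add_right htop (by simpa using hε.ne')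
  have hg : gauge K (-ζ) ≤ κ := gauge_le_of_youngSymm_lt hn hK.1.measure_lt_top.ne
    (IsConvexBody.volume_pos h0).ne' hκ.le hv hlt
  have hin : ⟪(-δ) • gradient (gauge K) x, ζ⟫ ≤ κ * δ := by
    rw [real_inner_smul_left, inner_gradient_left]
    have h1 := fderiv_gauge_le hK.2 (absorbent_nhds_zero (IsConvexBody.mem_nhds_zero h0)) hx (-ζ)
    rw [map_neg] at h1
    nlinarith
  rw [add_assoc, ← hτ']
  have h2 : ENNReal.ofReal (κ * δ - τ) ≤ e / ENNReal.ofReal c := by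
    rw [ENNReal.le_div_iff_mul_le (Or.inl (ENNReal.ofReal_pos.2 hc).ne')
      (Or.inl ENNReal.ofReal_ne_top), mul_comm, ← ENNReal.ofReal_mul hc.le]
    exact h τ κ hτ0 hκ hv
  calc ENNReal.ofReal ⟪(-δ) • gradient (gauge K) x, ζ⟫
      ≤ ENNReal.ofReal (κ * δ - τ + τ) := ENNReal.ofReal_le_ofReal (by linarith)
    _ ≤ _ := ENNReal.ofReal_add_le.trans (add_le_add h2 le_rfl)

theorem MemV1d.lintegral_yconj_youngSymm_le {Φ : Euc n → ℝ≥0∞} (hΦ : IsNYoung Φ)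
    {g : Euc n → Euc n} (hu : MemV1d Φ u g) (hn : 1 ≤ n) (hK : IsConvexBody K)
    (h0 : (0 : Euc n) ∈ interior K) :
    ∫⁻ x, yconj (youngSymm K (yconj Φ))
      ((- -deriv (fun r => decRearr u ((volume K).toReal * r ^ n)) (gauge K x)) •
        gradient (gauge K) x) ≤ ∫⁻ x, Φ (g x) := by
  have hV := hK.toReal_volume_pos h0
  obtain ⟨L, hL⟩ := hK.2.lipschitz_gauge (IsConvexBody.mem_nhds_zero h0)
  obtain ⟨e, hem, hle, he⟩ := hu.exists_energy_density hΦ hn hV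
  have hanti := hu.2.1.antitoneOn_profile hn hV
  set V := (volume K).toReal with hVdef
  have hn' : (0 : ℝ) < n := by exact_mod_cast hn
  have hG : Measurable fun r : ℝ => e r / ENNReal.ofReal (n * V * r ^ (n - 1)) :=
    hem.div (by fun_prop)
  have hpos : ∀ᵐ x, 0 < gauge K x := hK.ae_comp_gauge h0 hn (P := fun r => 0 < r)
    (ae_of_all _ fun r hr => hr)
  calc _ ≤ ∫⁻ x, e (gauge K x) / ENNReal.ofReal (n * V * gauge K x ^ (n - 1)) := by
        refine lintegral_mono_ae ?_
        filter_upwards [hL.ae_differentiableAt (μ := volume), hpos,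
          hK.ae_comp_gauge h0 hn (he.mono fun r hr h => hr)] with x hx hx0 hxe
        exact yconj_youngSymm_gradient_le hΦ hn hK h0 hx (by positivity)
          (neg_nonneg.2 (hanti.deriv_nonpos_of_pos hx0)) (hxe hx0)
    _ = ∫⁻ r in Ioi 0, e r := by
        rw [hK.lintegral_comp_gauge h0 hn hG]
        refine setLIntegral_congr_fun measurableSet_Ioi fun r hr => ?_
        have hr0 : 0 < r := hr
        exact ENNReal.mul_div_cancel (ENNReal.ofReal_pos.2 (by positivity)).ne'
          ENNReal.ofReal_ne_top
    _ ≤ _ := hle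

end PolyaSzego

/-- **Theorem (anisotropic Pólya–Szegő principle).** If `Φ` is an `n`-dimensional Young
function and `u ∈ V^{1,Φ}_d(ℝⁿ)`, then `u^K ∈ V^{1,Φ_{•K•}}_d(ℝⁿ)` and
`∫ Φ_{•K•}(∇u^K) ≤ ∫ Φ(∇u)`. -/
theorem statement0 {n : ℕ} (hn : 1 ≤ n) (K : Set (Euc n)) (hK : IsConvexBody K)
    (h0K : (0 : Euc n) ∈ interior K)
    (Φ : Euc n → ℝ≥0∞) (hΦ : IsNYoung Φ)
    (u : Euc n → ℝ) (gu : Euc n → Euc n) (hu : MemV1d Φ u gu) :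
    ∃ gK : Euc n → Euc n,
      MemV1d (yconj (youngSymm K (yconj Φ))) (funcSymm K u) gK ∧
      ∫⁻ x, yconj (youngSymm K (yconj Φ)) (gK x) ≤ ∫⁻ x, Φ (gu x) := by
  have hle := hu.lintegral_yconj_youngSymm_le hΦ hn hK h0K
  refine ⟨_, ⟨?_, hu.2.1.funcSymm hK h0K hn, hle.trans_lt hu.2.2⟩, hle⟩
  refine hK.hasWeakGradient_comp_gauge (f := fun r => decRearr u ((volume K).toReal * r ^ n))
    h0K hn (measurable_deriv _).neg
    (measurable_funcSymm hK h0K hn hu.2.1)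
    (hu.lintegral_deriv_profile_ne_top hΦ hn hK h0K) fun a b ha hab => ?_
  simp only [Pi.neg_apply]
  rw [intervalIntegral.integral_neg, (hu.absolutelyContinuousOnInterval hΦ hn
    (hK.toReal_volume_pos h0K) ha hab).integral_deriv_eq_sub, neg_sub]

end
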